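/- arXiv:1304.1345 — 16 statements merged into one kernel-verified Lean document; each statement's English description precedes it below -/
import Mathlib

section
/- Let Γ be a graph (undirected, loopless, nonempty vertex set P) satisfying conditions (A1)–(A4), and set n := diam Γ. Suppose a, b ∈ P are distinct points with the following property: there exists p ∈ P \ {a, b} such that for all x ∈ P, d(x,p) = n implies d(x,a) = n or d(x,b) = n. Then a and b are adjacent. -/
/-- If every vertex opposite to `p` is opposite to `a` or `b`, then `p` is adjacent to `a`. -/
theorem dist_eq_one_of_opposite_imp {V : Type*} {G : SimpleGraph V} (hconn : G.Connected)
    (hA2 : ∀ x y : V, ∃ z : V,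
      G.dist x z = G.dist x y + G.dist y z ∧ G.dist x z = G.diam)
    (hA4 : ∀ x y z : V, x ≠ y → G.dist x z = G.diam → G.dist y z = G.diam →
      ∃ w : V, G.dist z w = 1 ∧ G.dist x w = G.diam - 1 ∧ G.dist y w = G.diam)
    {a b p : V} (hpa : p ≠ a) (hpb : p ≠ b) (hpos : 0 < G.diam)
    (h : ∀ x : V, G.dist x p = G.diam → G.dist x a = G.diam ∨ G.dist x b = G.diam) :
    G.dist p a = 1 := by
  have hpos_pa : 0 < G.dist p a := hconn.pos_dist_of_ne hpa
  obtain ⟨x, hx, hpx⟩ := hA2 p a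
  have hbx : G.dist b x = G.diam := by
    have := h x (by rwa [G.dist_comm])
    rw [G.dist_comm (u := x) (v := a), G.dist_comm (u := x) (v := b)] at this
    omega
  obtain ⟨w, hxw, hbw, hpw⟩ := hA4 b p x hpb.symm hbx hpx
  have haw : G.dist a w = G.diam := by
    have := h w (by rwa [G.dist_comm])
    rw [G.dist_comm (u := w) (v := a), G.dist_comm (u := w) (v := b)] at this
    omega
  have := hconn.dist_triangle (u := a) (v := x) (w := w)
  omega


/-- Lemma 2.1 of the paper. For a graph `G` satisfying (A1)--(A4), if
`a ≠ b` and there is `p ∉ {a, b}` such that every point at distance `diam G` from `p`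
is at distance `diam G` from `a` or from `b`, then `a` and `b` are adjacent. -/
theorem stmt_0 {V : Type*} [Nonempty V] (G : SimpleGraph V)
    -- (A1): connected with finite diameter
    (hA1 : G.Connected ∧ G.ediam ≠ ⊤)
    -- (A2)
    (hA2 : ∀ x y : V, ∃ z : V,
      G.dist x z = G.dist x y + G.dist y z ∧ G.dist x z = G.diam)
    -- (A3)
    (hA3 : ∀ x y z : V, G.dist x z = 1 → G.dist y z = 1 → G.dist x y = 2 →
      ∃ w : V, G.dist x w = 1 ∧ G.dist y w = 1 ∧ G.dist z w = 2)
    -- (A4)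
    (hA4 : ∀ x y z : V, x ≠ y → G.dist x z = G.diam → G.dist y z = G.diam →
      ∃ w : V, G.dist z w = 1 ∧ G.dist x w = G.diam - 1 ∧ G.dist y w = G.diam)
    (a b : V) (hab : a ≠ b)
    (hp : ∃ p : V, p ≠ a ∧ p ≠ b ∧
      ∀ x : V, G.dist x p = G.diam → G.dist x a = G.diam ∨ G.dist x b = G.diam) :
    G.Adj a b := by
  obtain ⟨hconn, hfin⟩ := hA1
  obtain ⟨p, hpa, hpb, h⟩ := hp
  have hpos_ab : 0 < G.dist a b := hconn.pos_dist_of_ne hab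
  have hpos : 0 < G.diam := hpos_ab.trans_le (SimpleGraph.dist_le_diam hfin)
  have ha := dist_eq_one_of_opposite_imp hconn hA2 hA4 hpa hpb hpos h
  have hb := dist_eq_one_of_opposite_imp hconn hA2 hA4 hpb hpa hpos fun x hx => (h x hx).symm
  rw [G.dist_comm] at ha hb
  rw [← SimpleGraph.dist_eq_one_iff_adj]
  by_contra hne
  have htri := hconn.dist_triangle (u := a) (v := p) (w := b)
  rw [G.dist_comm (u := p) (v := b)] at htri
  obtain ⟨w, haw, hbw, hpw⟩ := hA3 a b p ha hb (by omega)
  obtain ⟨x, hx, hpx⟩ := hA2 p w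
  have hax := hconn.dist_triangle (u := a) (v := w) (w := x)
  have hbx := hconn.dist_triangle (u := b) (v := w) (w := x)
  have := h x (by rwa [G.dist_comm])
  rw [G.dist_comm (u := x) (v := a), G.dist_comm (u := x) (v := b)] at this
  omega
end

section
/- Let Γ and Γ' be graphs (with vertex sets P and P') both satisfying conditions (A1)–(A5). If φ : P → P' is a surjection such that for all x, y ∈ P one has d(x,y) = diam Γ if and only if d(φ(x), φ(y)) = diam Γ', then φ is an isomorphism of graphs, i.e. φ is bijective and both φ and φ⁻¹ map adjacent points to adjacent points. -/
/-- Condition (A1): the graph is connected and its diameter is finite. -/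
def CondA1 {V : Type*} (G : SimpleGraph V) : Prop :=
  G.Connected ∧ G.ediam ≠ ⊤

/-- Condition (A2). -/
def CondA2 {V : Type*} (G : SimpleGraph V) : Prop :=
  ∀ x y : V, ∃ z : V, G.dist x z = G.dist x y + G.dist y z ∧ G.dist x z = G.diam

/-- Condition (A3). -/
def CondA3 {V : Type*} (G : SimpleGraph V) : Prop :=
  ∀ x y z : V, G.dist x z = 1 → G.dist y z = 1 → G.dist x y = 2 →
    ∃ w : V, G.dist x w = 1 ∧ G.dist y w = 1 ∧ G.dist z w = 2

/-- Condition (A4). -/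
def CondA4 {V : Type*} (G : SimpleGraph V) : Prop :=
  ∀ x y z : V, x ≠ y → G.dist x z = G.diam → G.dist y z = G.diam →
    ∃ w : V, G.dist z w = 1 ∧ G.dist x w = G.diam - 1 ∧ G.dist y w = G.diam

/-- Condition (A5). -/
def CondA5 {V : Type*} (G : SimpleGraph V) : Prop :=
  ∀ a b : V, G.Adj a b → ∃ p : V, p ≠ a ∧ p ≠ b ∧
    ∀ x : V, G.dist x p = G.diam → G.dist x a = G.diam ∨ G.dist x b = G.diam

/-- In a connected graph satisfying (A2) and (A4), if every point opposite to `p` is opposite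
to `a` or to `b`, then `p` equals or is adjacent to `a`. -/
theorem dist_le_one_of_opposite_subset {V : Type*} {G : SimpleGraph V} (hc : G.Connected)
    (h2 : CondA2 G) (h4 : CondA4 G) {a b p : V} (hpa : p ≠ a) (hpb : p ≠ b)
    (h : ∀ x : V, G.dist x p = G.diam → G.dist x a = G.diam ∨ G.dist x b = G.diam) :
    G.dist p a ≤ 1 := by
  obtain ⟨z, hz, hzn⟩ := h2 p a
  have hpos : 0 < G.dist p a := hc.pos_dist_of_ne hpa
  have hzb : G.dist b z = G.diam := by
    rcases h z (by rw [G.dist_comm, hzn]) with h' | h'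
    · rw [G.dist_comm] at h'
      omega
    · rwa [G.dist_comm]
  obtain ⟨w, hzw, hbw, hpw⟩ := h4 b p z hpb.symm hzb hzn
  have htri : G.dist a w ≤ G.dist a z + G.dist z w := hc.dist_triangle
  rcases h w (by rw [G.dist_comm, hpw]) with h' | h' <;> rw [G.dist_comm] at h' <;> omega

/-- Adjacency is determined by the relation of being at maximal distance. -/
theorem adj_iff_exists_opposite_subset {V : Type*} {G : SimpleGraph V} (hc : G.Connected)
    (h2 : CondA2 G) (h3 : CondA3 G) (h4 : CondA4 G) (h5 : CondA5 G) (a b : V) :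
    G.Adj a b ↔ a ≠ b ∧ ∃ p : V, p ≠ a ∧ p ≠ b ∧
      ∀ x : V, G.dist x p = G.diam → G.dist x a = G.diam ∨ G.dist x b = G.diam := by
  refine ⟨fun hab => ⟨hab.ne, h5 a b hab⟩, ?_⟩
  rintro ⟨hab, p, hpa, hpb, h⟩
  have ha := dist_le_one_of_opposite_subset hc h2 h4 hpa hpb h
  have hb := dist_le_one_of_opposite_subset hc h2 h4 hpb hpa fun x hx => (h x hx).symm
  have ha0 : 0 < G.dist p a := hc.pos_dist_of_ne hpa
  have hb0 : 0 < G.dist p b := hc.pos_dist_of_ne hpb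
  have hab0 : 0 < G.dist a b := hc.pos_dist_of_ne hab
  have htri : G.dist a b ≤ G.dist a p + G.dist p b := hc.dist_triangle
  rw [G.dist_comm (u := a) (v := p)] at htri
  rw [← SimpleGraph.dist_eq_one_iff_adj]
  by_contra hne
  obtain ⟨w, haw, hbw, hpw⟩ :=
    h3 a b p (by rw [G.dist_comm]; omega) (by rw [G.dist_comm]; omega) (by omega)
  obtain ⟨z, hz, hzn⟩ := h2 p w
  have hta : G.dist a z ≤ G.dist a w + G.dist w z := hc.dist_triangle
  have htb : G.dist b z ≤ G.dist b w + G.dist w z := hc.dist_triangle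
  rcases h z (by rw [G.dist_comm, hzn]) with h' | h' <;> rw [G.dist_comm] at h' <;> omega

/-- Theorem 2.2 of the paper. A surjection between graphs satisfying
(A1)--(A5) which preserves pairs at maximal distance in both directions is an
isomorphism of graphs. -/
theorem stmt_1 {V V' : Type*} [Nonempty V] [Nonempty V']
    (G : SimpleGraph V) (G' : SimpleGraph V')
    (hG : CondA1 G ∧ CondA2 G ∧ CondA3 G ∧ CondA4 G ∧ CondA5 G)
    (hG' : CondA1 G' ∧ CondA2 G' ∧ CondA3 G' ∧ CondA4 G' ∧ CondA5 G')
    (φ : V → V') (hsurj : Function.Surjective φ)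
    (hdiam : ∀ x y : V, G.dist x y = G.diam ↔ G'.dist (φ x) (φ y) = G'.diam) :
    Function.Bijective φ ∧ ∀ x y : V, G.Adj x y ↔ G'.Adj (φ x) (φ y) := by
  obtain ⟨⟨hc, -⟩, h2, h3, h4, h5⟩ := hG
  obtain ⟨⟨hc', -⟩, h2', h3', h4', h5'⟩ := hG'
  have hinj : Function.Injective φ := by
    intro x y hxy
    by_contra hne
    have hpos : 0 < G.dist x y := hc.pos_dist_of_ne hne
    obtain ⟨z, hz, hzn⟩ := h2 x y
    have hyz : G.dist y z = G.diam := by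
      rw [hdiam, ← hxy, ← hdiam, hzn]
    omega
  refine ⟨⟨hinj, hsurj⟩, fun x y => ?_⟩
  rw [adj_iff_exists_opposite_subset hc h2 h3 h4 h5,
    adj_iff_exists_opposite_subset hc' h2' h3' h4' h5']
  simp only [hsurj.exists, hsurj.forall, hinj.ne_iff, hdiam]
end

section
/- Let Γ and Γ' be graphs (with vertex sets P and P') both satisfying conditions (A1)–(A5). If φ : P → P' is a surjection such that for all x, y ∈ P one has d(x,y) = diam Γ if and only if d(φ(x), φ(y)) = diam Γ', then diam Γ = diam Γ'. -/
/-- Graph homomorphisms do not increase distances in a connected graph. -/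
theorem SimpleGraph.Connected.dist_map_le {V V' : Type*} {G : SimpleGraph V}
    {G' : SimpleGraph V'} (hG : G.Connected) (f : G →g G') (u v : V) :
    G'.dist (f u) (f v) ≤ G.dist u v := by
  obtain ⟨p, hp⟩ := hG.exists_walk_length_eq_dist u v
  rw [← hp, ← SimpleGraph.Walk.length_map f p]
  exact SimpleGraph.dist_le _

/-- Surjective graph homomorphisms do not increase the diameter. -/
theorem SimpleGraph.Connected.diam_le_of_surjective {V V' : Type*} [Nonempty V']
    {G : SimpleGraph V} {G' : SimpleGraph V'} (hG : G.Connected) (hd : G.ediam ≠ ⊤)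
    (f : G →g G') (hf : Function.Surjective f) : G'.diam ≤ G.diam := by
  obtain ⟨u', v', h⟩ := G'.exists_dist_eq_diam
  obtain ⟨u, rfl⟩ := hf u'
  obtain ⟨v, rfl⟩ := hf v'
  rw [← h]
  exact (hG.dist_map_le f u v).trans (SimpleGraph.dist_le_diam hd)

/-- Isomorphic connected graphs of finite diameter have the same diameter. -/
theorem SimpleGraph.Iso.diam_eq_of_connected {V V' : Type*} [Nonempty V] [Nonempty V']
    {G : SimpleGraph V} {G' : SimpleGraph V'} (hG : CondA1 G) (hG' : CondA1 G')
    (f : G ≃g G') : G.diam = G'.diam :=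
  le_antisymm
    (hG'.1.diam_le_of_surjective hG'.2 f.symm.toHom f.symm.surjective)
    (hG.1.diam_le_of_surjective hG.2 f.toHom f.surjective)

/-- If every vertex opposite to `p` is opposite to `a` or to `b`, then `p` is adjacent or equal
to `a`. -/
theorem dist_le_one_of_opposite {V : Type*} {G : SimpleGraph V} (h1 : CondA1 G) (h2 : CondA2 G)
    (h4 : CondA4 G) {a b p : V} (hpa : p ≠ a) (hpb : p ≠ b)
    (h : ∀ x, G.dist x p = G.diam → G.dist x a = G.diam ∨ G.dist x b = G.diam) :
    G.dist p a ≤ 1 := by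
  obtain ⟨z, hz, hzd⟩ := h2 p a
  have hpos := h1.1.pos_dist_of_ne hpa
  have hza : G.dist z a ≠ G.diam := by rw [G.dist_comm]; omega
  have hzb : G.dist b z = G.diam := by
    rw [G.dist_comm]
    exact (h z (by rwa [G.dist_comm])).resolve_left hza
  obtain ⟨w, hzw, hbw, hpw⟩ := h4 b p z hpb.symm hzb hzd
  have hdiam : G.dist p a ≤ G.diam := SimpleGraph.dist_le_diam h1.2
  have hwb : G.dist w b ≠ G.diam := by rw [G.dist_comm]; omega
  have hwa := (h w (by rwa [G.dist_comm])).resolve_right hwb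
  have htri : G.dist a w ≤ G.dist a z + G.dist z w := h1.1.dist_triangle
  rw [G.dist_comm] at hwa
  omega

/-- Two distinct vertices are adjacent if and only if there is a third vertex `p` such that every
vertex opposite to `p` is opposite to one of the two. -/
theorem adj_iff_exists_opposite {V : Type*} {G : SimpleGraph V} (h1 : CondA1 G) (h2 : CondA2 G)
    (h3 : CondA3 G) (h4 : CondA4 G) (h5 : CondA5 G) {a b : V} :
    G.Adj a b ↔ a ≠ b ∧ ∃ p, p ≠ a ∧ p ≠ b ∧
      ∀ x, G.dist x p = G.diam → G.dist x a = G.diam ∨ G.dist x b = G.diam := by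
  refine ⟨fun hab => ⟨hab.ne, h5 a b hab⟩, ?_⟩
  rintro ⟨hab, p, hpa, hpb, h⟩
  have ha := dist_le_one_of_opposite h1 h2 h4 hpa hpb h
  have hb := dist_le_one_of_opposite h1 h2 h4 hpb hpa fun x hx => (h x hx).symm
  have ha0 := h1.1.pos_dist_of_ne hpa
  have hb0 := h1.1.pos_dist_of_ne hpb
  have hab0 := h1.1.pos_dist_of_ne hab
  have hap : G.dist a p = 1 := by rw [G.dist_comm]; omega
  have hbp : G.dist b p = 1 := by rw [G.dist_comm]; omega
  rw [← SimpleGraph.dist_eq_one_iff_adj]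
  by_contra hne
  have htri : G.dist a b ≤ G.dist a p + G.dist p b := h1.1.dist_triangle
  obtain ⟨w, haw, hbw, hpw⟩ := h3 a b p hap hbp (by omega)
  obtain ⟨z, hz, hzd⟩ := h2 p w
  have haz : G.dist a z ≤ G.dist a w + G.dist w z := h1.1.dist_triangle
  have hbz : G.dist b z ≤ G.dist b w + G.dist w z := h1.1.dist_triangle
  rcases h z (by rwa [G.dist_comm]) with hh | hh <;> rw [G.dist_comm] at hh <;> omega

/-- A map preserving and reflecting oppositeness is injective on a graph satisfying (A1), (A2)
and (A4). -/
theorem injective_of_opposite_iff {V V' : Type*} {G : SimpleGraph V} {G' : SimpleGraph V'}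
    (h1 : CondA1 G) (h2 : CondA2 G) (h4 : CondA4 G) {φ : V → V'}
    (hφ : ∀ x y, G.dist x y = G.diam ↔ G'.dist (φ x) (φ y) = G'.diam) :
    Function.Injective φ := by
  intro x y hxy
  by_contra hne
  have hopp : ∀ z, G.dist x z = G.diam ↔ G.dist y z = G.diam := fun z => by
    rw [hφ, hφ, hxy]
  obtain ⟨z, -, hz⟩ := h2 x x
  obtain ⟨w, -, hxw, hyw⟩ := h4 x y z hne hz ((hopp z).1 hz)
  have hpos := h1.1.pos_dist_of_ne hne
  have hle : G.dist x y ≤ G.diam := SimpleGraph.dist_le_diam h1.2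
  have := (hopp w).2 hyw
  omega

/-- STATEMENT 1: Theorem 2.2 of the paper. A surjection between graphs satisfying
(A1)--(A5) which preserves pairs at maximal distance in both directions is an
isomorphism; in particular the diameters agree. -/
theorem stmt_2 {V V' : Type*} [Nonempty V] [Nonempty V']
    (G : SimpleGraph V) (G' : SimpleGraph V')
    (hG : CondA1 G ∧ CondA2 G ∧ CondA3 G ∧ CondA4 G ∧ CondA5 G)
    (hG' : CondA1 G' ∧ CondA2 G' ∧ CondA3 G' ∧ CondA4 G' ∧ CondA5 G')
    (φ : V → V') (hsurj : Function.Surjective φ)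
    (hdiam : ∀ x y : V, G.dist x y = G.diam ↔ G'.dist (φ x) (φ y) = G'.diam) :
    G.diam = G'.diam := by
  obtain ⟨h1, h2, h3, h4, h5⟩ := hG
  obtain ⟨h1', h2', h3', h4', h5'⟩ := hG'
  have hinj := injective_of_opposite_iff h1 h2 h4 hdiam
  have hadj : ∀ a b, G'.Adj (φ a) (φ b) ↔ G.Adj a b := fun a b => by
    rw [adj_iff_exists_opposite h1 h2 h3 h4 h5, adj_iff_exists_opposite h1' h2' h3' h4' h5']
    simp only [hsurj.exists, hsurj.forall, hinj.ne_iff, ← hdiam]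
  exact SimpleGraph.Iso.diam_eq_of_connected h1 h1'
    ⟨Equiv.ofBijective φ ⟨hinj, hsurj⟩, fun {a b} => hadj a b⟩
end

section
/- Let D be a division ring and m, n ≥ 2 integers. For any A, B ∈ M_{m×n}(D) there exists C ∈ M_{m×n}(D) such that rank(A − C) = rank(A − B) + rank(B − C) and rank(A − C) = min{m,n}. (This is condition (A2) for the graph on M_{m×n}(D), since the graph distance equals the rank of the difference.) -/
/-- The left row rank of a matrix over a division ring `D`: the dimension of the
subspace of the left vector space `D^n` spanned by the rows. -/
noncomputable def rowRank {D : Type*} [DivisionRing D] {m n : ℕ}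
    (A : Matrix (Fin m) (Fin n) D) : ℕ :=
  Module.finrank D (Submodule.span D (Set.range fun i => A i))

open Module Submodule in
/-- Between finite-dimensional spaces there is a linear map of the largest conceivable rank. -/
theorem exists_linearMap_finrank_range_eq_min (K V W : Type*) [DivisionRing K]
    [AddCommGroup V] [Module K V] [FiniteDimensional K V]
    [AddCommGroup W] [Module K W] [FiniteDimensional K W] :
    ∃ h : V →ₗ[K] W, finrank K (LinearMap.range h) = min (finrank K V) (finrank K W) := by
  rcases le_total (finrank K V) (finrank K W) with hle | hle
  · obtain ⟨h, hh⟩ := finrank_le_iff_exists_linearMap.1 hle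
    exact ⟨h, by rw [LinearMap.finrank_range_of_inj hh, min_eq_left hle]⟩
  · obtain ⟨i, hi⟩ := finrank_le_iff_exists_linearMap.1 hle
    obtain ⟨h, hh⟩ := i.exists_leftInverse_of_injective (LinearMap.ker_eq_bot.2 hi)
    have hs : Function.Surjective h := fun w => ⟨i w, LinearMap.congr_fun hh w⟩
    exact ⟨h, by rw [LinearMap.range_eq_top.2 hs, finrank_top, min_eq_right hle]⟩

open Module Submodule in
/-- Every linear map between finite-dimensional spaces can be completed to one of maximal rank by
adding a map of complementary rank. -/
theorem LinearMap.exists_finrank_range_add_eq_min {K V W : Type*} [DivisionRing K]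
    [AddCommGroup V] [Module K V] [FiniteDimensional K V]
    [AddCommGroup W] [Module K W] [FiniteDimensional K W] (f : V →ₗ[K] W) :
    ∃ g : V →ₗ[K] W,
      finrank K (range (f + g)) = finrank K (range f) + finrank K (range g) ∧
      finrank K (range (f + g)) = min (finrank K V) (finrank K W) := by
  obtain ⟨V', hV⟩ := (ker f).exists_isCompl
  obtain ⟨W', hW⟩ := (range f).exists_isCompl
  obtain ⟨h, hh⟩ := exists_linearMap_finrank_range_eq_min K (ker f) W'
  set g : V →ₗ[K] W := W'.subtype ∘ₗ h ∘ₗ projectionOnto (ker f) V' hV with hg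
  have hgW : range g ≤ W' := by
    rintro _ ⟨x, rfl⟩
    exact (h _).2
  have hrg : finrank K (range g) = min (finrank K (ker f)) (finrank K W') := by
    rw [← hh, hg, range_comp, LinearMap.range_comp_of_range_eq_top _ (range_projectionOnto hV)]
    exact finrank_map_subtype_eq _ _
  have hrange : range (f + g) = range f ⊔ range g := by
    apply le_antisymm
    · rintro _ ⟨x, rfl⟩
      exact add_mem_sup ⟨x, rfl⟩ ⟨x, rfl⟩
    · have hfP (x : V) : f ((ker f).projection V' hV x) = 0 :=
        (projection_apply_mem hV x)
      have hgP (x : V) : g ((ker f).projection V' hV x) = g x := by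
        rw [projection_apply]
        simp only [hg, comp_apply, projectionOnto_apply_left]
      refine sup_le ?_ ?_
      · rintro _ ⟨x, rfl⟩
        exact ⟨x - (ker f).projection V' hV x, by simp [hfP, hgP]⟩
      · rintro _ ⟨x, rfl⟩
        exact ⟨(ker f).projection V' hV x, by simp [hfP, hgP]⟩
  have hsum : finrank K (range (f + g)) = finrank K (range f) + finrank K (range g) := by
    have := finrank_sup_add_finrank_inf_eq (range f) (range g)
    rwa [(hW.disjoint.mono_right hgW).eq_bot, finrank_bot, add_zero, ← hrange] at this
  refine ⟨g, hsum, ?_⟩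
  have h1 := f.finrank_range_add_finrank_ker
  have h2 := finrank_add_eq_of_isCompl hW
  omega

/-- The row rank of the matrix of a linear map is the rank of the map. -/
theorem rowRank_apply_basisFun {D : Type*} [DivisionRing D] {m n : ℕ}
    (f : (Fin m → D) →ₗ[D] (Fin n → D)) :
    rowRank (Matrix.of fun i => f (Pi.basisFun D (Fin m) i)) =
      Module.finrank D (LinearMap.range f) := by
  rw [LinearMap.range_eq_map, ← (Pi.basisFun D (Fin m)).span_eq, Submodule.map_span,
    ← Set.range_comp]
  rfl

/-- condition (A2) for the graph on rectangular matrices over a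
division ring (graph distance = rank of the difference, diameter = min{m,n}). -/
theorem stmt_3 {D : Type*} [DivisionRing D] {m n : ℕ} (hm : 2 ≤ m) (hn : 2 ≤ n)
    (A B : Matrix (Fin m) (Fin n) D) :
    ∃ C : Matrix (Fin m) (Fin n) D,
      rowRank (A - C) = rowRank (A - B) + rowRank (B - C) ∧
      rowRank (A - C) = min m n := by
  obtain ⟨g, hadd, hmin⟩ :=
    ((Pi.basisFun D (Fin m)).constr ℕ (A - B)).exists_finrank_range_add_eq_min
  have hAB : (Matrix.of fun i => (Pi.basisFun D (Fin m)).constr ℕ (A - B)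
      (Pi.basisFun D (Fin m) i)) = A - B :=
    funext fun i => (Pi.basisFun D (Fin m)).constr_basis (M' := Fin n → D) ℕ (A - B) i
  set N : Matrix (Fin m) (Fin n) D := Matrix.of fun i => g (Pi.basisFun D (Fin m) i) with hN
  have hAC : A - (B - N) = Matrix.of fun i => ((Pi.basisFun D (Fin m)).constr ℕ (A - B) + g)
      (Pi.basisFun D (Fin m) i) := by
    rw [sub_sub_eq_add_sub, add_sub_right_comm]
    nth_rw 1 [← hAB]
    rfl
  simp only [← rowRank_apply_basisFun, ← hAC, hAB, ← hN] at hadd hmin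
  refine ⟨B - N, ?_, ?_⟩
  · rw [hadd, sub_sub_cancel]
  · simpa using hmin
end

section
/- Let D be a division ring and m, n ≥ 2 integers. For any X, Y, Z ∈ M_{m×n}(D) with rank(X − Z) = rank(Y − Z) = 1 and rank(X − Y) = 2, there exists W ∈ M_{m×n}(D) with rank(X − W) = rank(Y − W) = 1 and rank(Z − W) = 2. (This is condition (A3) for the graph on M_{m×n}(D).) -/
/-- Negating a matrix does not change its left row rank. -/
theorem rowRank_neg {D : Type*} [DivisionRing D] {m n : ℕ}
    (A : Matrix (Fin m) (Fin n) D) : rowRank (-A) = rowRank A := by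
  have h : Set.range (fun i => (-A) i) = -Set.range (fun i => A i) := by
    ext v
    simp only [Set.mem_range, Set.mem_neg]
    exact exists_congr fun i => neg_eq_iff_eq_neg
  rw [rowRank, rowRank, h, Submodule.span_neg_eq_neg, Submodule.neg_eq_self]

/-- Two disjoint subspaces admit an endomorphism fixing the first and negating the second. -/
theorem exists_linearMap_eq_id_neg_of_disjoint {D V : Type*} [DivisionRing D] [AddCommGroup V]
    [Module D V] {P Q : Submodule D V} (h : Disjoint P Q) :
    ∃ T : V →ₗ[D] V, (∀ x ∈ P, T x = x) ∧ ∀ y ∈ Q, T y = -y := by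
  obtain ⟨R, hQR, hPR⟩ := h.symm.exists_isCompl
  refine ⟨LinearMap.ofIsCompl hPR.symm P.subtype (-R.subtype), fun x hx => ?_, fun y hy => ?_⟩
  · exact LinearMap.ofIsCompl_apply_left hPR.symm ⟨x, hx⟩
  · exact LinearMap.ofIsCompl_apply_right hPR.symm ⟨y, hQR hy⟩

/-- If a difference of two matrices of left row rank one has left row rank two,
then so does their sum. -/
theorem rowRank_add_eq_two_of_rowRank_sub_eq_two {D : Type*} [DivisionRing D] {m n : ℕ}
    {A B : Matrix (Fin m) (Fin n) D} (hA : rowRank A = 1) (hB : rowRank B = 1)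
    (hAB : rowRank (A - B) = 2) : rowRank (A + B) = 2 := by
  unfold rowRank at *
  set P := Submodule.span D (Set.range fun i => A i)
  set Q := Submodule.span D (Set.range fun i => B i)
  have hP (i) : A i ∈ P := Submodule.subset_span ⟨i, rfl⟩
  have hQ (i) : B i ∈ Q := Submodule.subset_span ⟨i, rfl⟩
  have hsub : Submodule.span D (Set.range fun i => (A - B) i) ≤ P ⊔ Q := by
    rw [Submodule.span_le]
    rintro _ ⟨i, rfl⟩
    exact sub_mem (Submodule.mem_sup_left (hP i)) (Submodule.mem_sup_right (hQ i))
  have hadd : Submodule.span D (Set.range fun i => (A + B) i) ≤ P ⊔ Q := by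
    rw [Submodule.span_le]
    rintro _ ⟨i, rfl⟩
    exact add_mem (Submodule.mem_sup_left (hP i)) (Submodule.mem_sup_right (hQ i))
  have hdim := Submodule.finrank_sup_add_finrank_inf_eq P Q
  have hsub' := Submodule.finrank_mono hsub
  have hadd' := Submodule.finrank_mono hadd
  have hdisj : Disjoint P Q := by
    rw [disjoint_iff, ← Submodule.finrank_eq_zero (R := D)]
    omega
  obtain ⟨T, hTP, hTQ⟩ := exists_linearMap_eq_id_neg_of_disjoint hdisj
  have hmap : Submodule.span D (Set.range fun i => (A - B) i) ≤
      (Submodule.span D (Set.range fun i => (A + B) i)).map T := by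
    rw [Submodule.span_le]
    rintro _ ⟨i, rfl⟩
    refine ⟨(A + B) i, Submodule.subset_span ⟨i, rfl⟩, ?_⟩
    change T (A i + B i) = A i - B i
    rw [map_add, hTP _ (hP i), hTQ _ (hQ i), sub_eq_add_neg]
  have hmap' := (Submodule.finrank_mono hmap).trans (Submodule.finrank_map_le T _)
  omega

/-- condition (A3) for the graph on rectangular matrices over a
division ring (graph distance = rank of the difference). -/
theorem stmt_4 {D : Type*} [DivisionRing D] {m n : ℕ} (hm : 2 ≤ m) (hn : 2 ≤ n)
    (X Y Z : Matrix (Fin m) (Fin n) D)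
    (hXZ : rowRank (X - Z) = 1) (hYZ : rowRank (Y - Z) = 1)
    (hXY : rowRank (X - Y) = 2) :
    ∃ W : Matrix (Fin m) (Fin n) D,
      rowRank (X - W) = 1 ∧ rowRank (Y - W) = 1 ∧ rowRank (Z - W) = 2 := by
  refine ⟨X + Y - Z, ?_, ?_, ?_⟩
  · rwa [show X - (X + Y - Z) = -(Y - Z) by abel, rowRank_neg]
  · rwa [show Y - (X + Y - Z) = -(X - Z) by abel, rowRank_neg]
  · rw [show Z - (X + Y - Z) = -((X - Z) + (Y - Z)) by abel, rowRank_neg]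
    exact rowRank_add_eq_two_of_rowRank_sub_eq_two hXZ hYZ (by rwa [sub_sub_sub_cancel_right])
end

section
/- Let D be a division ring and m, n ≥ 2 integers. For any X, Y, Z ∈ M_{m×n}(D) with X ≠ Y and rank(X − Z) = rank(Y − Z) = min{m,n}, there exists W ∈ M_{m×n}(D) with rank(Z − W) = 1, rank(X − W) = min{m,n} − 1, and rank(Y − W) = min{m,n}. (This is condition (A4) for the graph on M_{m×n}(D).) -/
section LinearMaps

open Module

variable {D V W : Type*} [DivisionRing D] [AddCommGroup V] [AddCommGroup W] [Module D V]
  [Module D W]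

theorem exists_functional_apply_eq_one_apply_ne_zero {x z : V} (hx : x ≠ 0) (hz : z ≠ 0) :
    ∃ φ : V →ₗ[D] D, φ x = 1 ∧ φ z ≠ 0 := by
  obtain ⟨φ, -, hφ⟩ := LinearMap.exists_extend_of_notMem (0 : (⊥ : Submodule D V) →ₗ[D] D)
    (v := x) (by simpa using hx) 1
  by_cases hφz : φ z = 0
  · have hzx : z ∉ Submodule.span D {x} := by
      rintro h
      obtain ⟨c, rfl⟩ := Submodule.mem_span_singleton.1 h
      have hc : c = 0 := by simpa [hφ] using hφz
      simp [hc] at hz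
    obtain ⟨ψ, hψ, hψz⟩ :=
      LinearMap.exists_extend_of_notMem (0 : Submodule.span D {x} →ₗ[D] D) hzx 1
    have hψx : ψ x = 0 := by
      simpa using LinearMap.congr_fun hψ ⟨x, Submodule.mem_span_singleton_self x⟩
    exact ⟨φ + ψ, by simp [hφ, hψx], by simp [hφz, hψz]⟩
  · exact ⟨φ, hφ, hφz⟩

theorem exists_vector_apply_eq_one_apply_ne_zero {ψ η : V →ₗ[D] D} (hψ : ψ ≠ 0) (hη : η ≠ 0) :
    ∃ w, ψ w = 1 ∧ η w ≠ 0 := by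
  obtain ⟨w, hw⟩ := LinearMap.surjective hψ 1
  obtain ⟨u, hu⟩ := DFunLike.ne_iff.1 hη
  rw [LinearMap.zero_apply] at hu
  by_cases hηw : η w = 0
  · by_cases hψu : ψ u = 0
    · exact ⟨w + u, by simp [hw, hψu], by simpa [hηw] using hu⟩
    · exact ⟨(ψ u)⁻¹ • u, by simp [hψu], by simp [hψu, hu]⟩
  · exact ⟨w, hw, hηw⟩

theorem finrank_range_smulRight_eq_one {φ : V →ₗ[D] D} (hφ : φ ≠ 0) {w : W} (hw : w ≠ 0) :
    finrank D (LinearMap.range (φ.smulRight w)) = 1 := by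
  rw [LinearMap.range_smulRight_apply hφ, finrank_span_singleton hw]

theorem exists_rank_one_sub_of_injective [FiniteDimensional D V] {f g : V →ₗ[D] W}
    (hf : Function.Injective f) (hg : Function.Injective g) (hfg : f ≠ g) :
    ∃ r : V →ₗ[D] W, finrank D (LinearMap.range r) = 1 ∧
      finrank D (LinearMap.range (f - r)) = finrank D V - 1 ∧
      finrank D (LinearMap.range (g - r)) = finrank D V := by
  obtain ⟨x, hx⟩ := DFunLike.ne_iff.1 hfg
  have hx0 : x ≠ 0 := by rintro rfl; simp at hx
  obtain ⟨φ, hφx, hφ⟩ : ∃ φ : V →ₗ[D] D, φ x = 1 ∧ ∀ y, g y = f x → φ y ≠ 1 := by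
    by_cases h : ∃ y, g y = f x
    · obtain ⟨y, hy⟩ := h
      have hyx : y - x ≠ 0 := by
        rw [sub_ne_zero]; rintro rfl; exact hx hy.symm
      obtain ⟨φ, h1, h2⟩ := exists_functional_apply_eq_one_apply_ne_zero (D := D) hx0 hyx
      refine ⟨φ, h1, fun y' hy' => ?_⟩
      rw [hg (hy'.trans hy.symm)]
      simpa [h1, sub_ne_zero] using h2
    · obtain ⟨φ, h1, -⟩ := exists_functional_apply_eq_one_apply_ne_zero (D := D) hx0 hx0
      exact ⟨φ, h1, fun y hy => (h ⟨y, hy⟩).elim⟩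
  have hφ0 : φ ≠ 0 := by rintro rfl; simp at hφx
  refine ⟨φ.smulRight (f x), finrank_range_smulRight_eq_one hφ0 ?_, ?_, ?_⟩
  · exact (map_ne_zero_iff f hf).2 hx0
  · have hker : LinearMap.ker (f - φ.smulRight (f x)) = Submodule.span D {x} := by
      ext y
      rw [Submodule.mem_span_singleton, LinearMap.mem_ker, LinearMap.sub_apply,
        LinearMap.smulRight_apply, ← map_smul, sub_eq_zero, hf.eq_iff]
      constructor
      · intro h
        exact ⟨φ y, h.symm⟩
      · rintro ⟨c, rfl⟩
        simp [hφx]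
    have := (f - φ.smulRight (f x)).finrank_range_add_finrank_ker
    rw [hker, finrank_span_singleton hx0] at this
    omega
  · refine LinearMap.finrank_range_of_inj ((injective_iff_map_eq_zero _).2 fun y hy => ?_)
    rw [LinearMap.sub_apply, LinearMap.smulRight_apply, sub_eq_zero] at hy
    by_cases h : φ y = 0
    · rw [h, zero_smul] at hy
      exact (map_eq_zero_iff g hg).1 hy
    · refine (hφ ((φ y)⁻¹ • y) ?_ ?_).elim
      · rw [map_smul, hy, inv_smul_smul₀ h]
      · simp [h]

theorem exists_rank_one_sub_of_surjective [FiniteDimensional D W] {f g : V →ₗ[D] W}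
    (hf : Function.Surjective f) (hg : Function.Surjective g) (hfg : f ≠ g) :
    ∃ r : V →ₗ[D] W, finrank D (LinearMap.range r) = 1 ∧
      finrank D (LinearMap.range (f - r)) = finrank D W - 1 ∧
      finrank D (LinearMap.range (g - r)) = finrank D W := by
  obtain ⟨x, hx⟩ := DFunLike.ne_iff.1 hfg
  obtain ⟨ψ, hψ, -⟩ := exists_functional_apply_eq_one_apply_ne_zero (D := D)
    (sub_ne_zero.2 hx) (sub_ne_zero.2 hx)
  have hψ0 : ψ ≠ 0 := by rintro rfl; simp at hψ
  have hψfg : ψ ∘ₗ g ≠ ψ ∘ₗ f := by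
    intro h
    have := LinearMap.congr_fun h x
    simp only [LinearMap.comp_apply] at this
    simp [this] at hψ
  obtain ⟨w, hψw, hw⟩ : ∃ w, ψ w = 1 ∧ ∀ χ : W →ₗ[D] D, χ ∘ₗ g = ψ ∘ₗ f → χ w ≠ 1 := by
    by_cases h : ∃ χ : W →ₗ[D] D, χ ∘ₗ g = ψ ∘ₗ f
    · obtain ⟨χ, hχ⟩ := h
      have hχψ : χ - ψ ≠ 0 := by
        rw [sub_ne_zero]; rintro rfl; exact hψfg hχ
      obtain ⟨w, h1, h2⟩ := exists_vector_apply_eq_one_apply_ne_zero hψ0 hχψ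
      refine ⟨w, h1, fun χ' hχ' => ?_⟩
      rw [(LinearMap.cancel_right hg).1 (hχ'.trans hχ.symm)]
      simpa [h1, sub_ne_zero] using h2
    · obtain ⟨w, h1, -⟩ := exists_vector_apply_eq_one_apply_ne_zero hψ0 hψ0
      exact ⟨w, h1, fun χ hχ => (h ⟨χ, hχ⟩).elim⟩
  have hw0 : w ≠ 0 := by rintro rfl; simp at hψw
  have hψf0 : ψ ∘ₗ f ≠ 0 := by
    intro h
    obtain ⟨v, rfl⟩ := hf w
    simpa [hψw] using LinearMap.congr_fun h v
  refine ⟨(ψ ∘ₗ f).smulRight w, finrank_range_smulRight_eq_one hψf0 hw0, ?_, ?_⟩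
  · have hrange : LinearMap.range (f - (ψ ∘ₗ f).smulRight w) = LinearMap.ker ψ := by
      ext u
      rw [LinearMap.mem_range, LinearMap.mem_ker]
      constructor
      · rintro ⟨v, rfl⟩
        simp [hψw]
      · intro hu
        obtain ⟨v, rfl⟩ := hf u
        exact ⟨v, by simp [hu]⟩
    have := ψ.finrank_range_add_finrank_ker
    rw [LinearMap.range_eq_top.2 (LinearMap.surjective hψ0), finrank_top, finrank_self] at this
    rw [hrange]
    omega
  · suffices h : LinearMap.range (g - (ψ ∘ₗ f).smulRight w) = ⊤ by rw [h, finrank_top]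
    by_contra h
    obtain ⟨χ, hχ0, hχ⟩ := Submodule.exists_le_ker_of_lt_top _ (lt_top_iff_ne_top.2 h)
    have hχg (v : V) : χ (g v) = ψ (f v) * χ w := by
      simpa [sub_eq_zero] using hχ (LinearMap.mem_range_self _ v)
    by_cases hχw : χ w = 0
    · refine hχ0 (LinearMap.ext fun u => ?_)
      obtain ⟨v, rfl⟩ := hg u
      simp [hχg, hχw]
    · refine hw (χ.smulRight (χ w)⁻¹) (LinearMap.ext fun v => ?_) ?_
      · simp [hχg, hχw]
      · simp [hχw]

theorem exists_rank_one_sub_of_finrank_range_eq_min [FiniteDimensional D V]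
    [FiniteDimensional D W] {f g : V →ₗ[D] W}
    (hf : finrank D (LinearMap.range f) = min (finrank D V) (finrank D W))
    (hg : finrank D (LinearMap.range g) = min (finrank D V) (finrank D W)) (hfg : f ≠ g) :
    ∃ r : V →ₗ[D] W, finrank D (LinearMap.range r) = 1 ∧
      finrank D (LinearMap.range (f - r)) = min (finrank D V) (finrank D W) - 1 ∧
      finrank D (LinearMap.range (g - r)) = min (finrank D V) (finrank D W) := by
  rcases le_total (finrank D V) (finrank D W) with h | h
  · rw [min_eq_left h] at *
    have inj {k : V →ₗ[D] W} (hk : finrank D (LinearMap.range k) = finrank D V) :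
        Function.Injective k := by
      have := k.finrank_range_add_finrank_ker
      exact LinearMap.ker_eq_bot.1 (Submodule.finrank_eq_zero.1 (by omega))
    exact exists_rank_one_sub_of_injective (inj hf) (inj hg) hfg
  · rw [min_eq_right h] at *
    have surj {k : V →ₗ[D] W} (hk : finrank D (LinearMap.range k) = finrank D W) :
        Function.Surjective k :=
      LinearMap.range_eq_top.1 (Submodule.eq_top_of_finrank_eq hk)
    exact exists_rank_one_sub_of_surjective (surj hf) (surj hg) hfg

theorem rowRank_eq_finrank_range {m n : ℕ} (A : Matrix (Fin m) (Fin n) D) :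
    rowRank A = finrank D (LinearMap.range (Matrix.toLinearMapRight' A)) :=
  congrArg (fun p : Submodule D (Fin n → D) => finrank D p) (range_vecMulLinear A).symm

end LinearMaps

/-- condition (A4) for the graph on rectangular matrices over a
division ring (graph distance = rank of the difference, diameter = min{m,n}). -/
theorem stmt_5 {D : Type*} [DivisionRing D] {m n : ℕ} (hm : 2 ≤ m) (hn : 2 ≤ n)
    (X Y Z : Matrix (Fin m) (Fin n) D) (hXY : X ≠ Y)
    (hXZ : rowRank (X - Z) = min m n) (hYZ : rowRank (Y - Z) = min m n) :
    ∃ W : Matrix (Fin m) (Fin n) D,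
      rowRank (Z - W) = 1 ∧ rowRank (X - W) = min m n - 1 ∧
      rowRank (Y - W) = min m n := by
  simp only [rowRank_eq_finrank_range] at hXZ hYZ ⊢
  have hne : Matrix.toLinearMapRight' (X - Z) ≠ Matrix.toLinearMapRight' (Y - Z) := by
    simpa using hXY
  obtain ⟨r, h1, h2, h3⟩ := exists_rank_one_sub_of_finrank_range_eq_min
    (by simpa using hXZ) (by simpa using hYZ) hne
  obtain ⟨R, rfl⟩ := Matrix.toLinearMapRight'.surjective r
  rw [← map_sub] at h2 h3
  refine ⟨Z + R, ?_, ?_, ?_⟩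
  · rwa [sub_add_cancel_left, map_neg, LinearMap.range_neg]
  · rw [sub_add_eq_sub_sub, h2, Module.finrank_fin_fun, Module.finrank_fin_fun]
  · rw [sub_add_eq_sub_sub, h3, Module.finrank_fin_fun, Module.finrank_fin_fun]
end

section
/- Let D be a division ring with |D| ≠ 2 and m, n ≥ 2 integers. For any A, B ∈ M_{m×n}(D) with rank(A − B) = 1 there exists P ∈ M_{m×n}(D) \ {A, B} such that for all X ∈ M_{m×n}(D): if rank(X − P) = min{m,n}, then rank(X − A) = min{m,n} or rank(X − B) = min{m,n}. (This is condition (A5) for the graph on M_{m×n}(D).) -/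
section RankOnePerturbation

variable {D V ι : Type*} [DivisionRing D] [AddCommGroup V] [Module D V]

/-- Along a line of rank-one perturbations of a linearly independent family, linear independence
fails for at most one parameter. -/
theorem eq_of_not_linearIndependent_add_smul [Fintype ι] {R : ι → V}
    (hR : LinearIndependent D R) (u : ι → D) (v : V) {μ ν : D}
    (hμ : ¬ LinearIndependent D fun i => R i + (u i * μ) • v)
    (hν : ¬ LinearIndependent D fun i => R i + (u i * ν) • v) : μ = ν := by
  have key : ∀ {κ : D}, (¬ LinearIndependent D fun i => R i + (u i * κ) • v) →
      ∃ w : ι → D, ∑ i, w i • R i = -v ∧ ∑ i, w i * u i = κ⁻¹ := by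
    intro κ hκ
    obtain ⟨w, hw, i, hi⟩ := Fintype.not_linearIndependent_iff.1 hκ
    have hsum : ∑ i, w i • R i + ((∑ i, w i * u i) * κ) • v = 0 := by
      rw [← hw, Finset.sum_mul, Finset.sum_smul, ← Finset.sum_add_distrib]
      simp only [smul_add, smul_smul, mul_assoc]
    have hc : (∑ i, w i * u i) * κ ≠ 0 := by
      intro h
      rw [h, zero_smul, add_zero] at hsum
      exact hi (Fintype.linearIndependent_iff.1 hR w hsum i)
    refine ⟨fun i => ((∑ i, w i * u i) * κ)⁻¹ * w i, ?_, ?_⟩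
    · simp only [mul_smul]
      rw [← Finset.smul_sum, eq_neg_of_add_eq_zero_left hsum, smul_neg, inv_smul_smul₀ hc]
    · simp only [mul_assoc]
      rw [← Finset.mul_sum, mul_inv_rev, inv_mul_cancel_right₀ (left_ne_zero_of_mul hc)]
  obtain ⟨w, hw, hwu⟩ := key hμ
  obtain ⟨w', hw', hwu'⟩ := key hν
  have hww' : ∀ i, w i - w' i = 0 :=
    Fintype.linearIndependent_iff.1 hR (fun i => w i - w' i) (by
      simp only [sub_smul, Finset.sum_sub_distrib, hw, hw', sub_self])
  have : w = w' := funext fun i => sub_eq_zero.1 (hww' i)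
  exact inv_injective (by rw [← hwu, ← hwu', this])

/-- Along a line of rank-one perturbations of a spanning family, the spanning property
fails for at most one parameter. -/
theorem eq_of_span_range_add_smul_ne_top {R : ι → V}
    (hR : Submodule.span D (Set.range R) = ⊤) (u : ι → D) (v : V) {μ ν : D}
    (hμ : Submodule.span D (Set.range fun i => R i + (u i * μ) • v) ≠ ⊤)
    (hν : Submodule.span D (Set.range fun i => R i + (u i * ν) • v) ≠ ⊤) : μ = ν := by
  have key : ∀ {κ : D}, Submodule.span D (Set.range fun i => R i + (u i * κ) • v) ≠ ⊤ →
      ∃ f : V →ₗ[D] D, (∀ i, f (R i) = -u i) ∧ f v = κ⁻¹ := by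
    intro κ hκ
    obtain ⟨f, hf, hle⟩ := Submodule.exists_le_ker_of_lt_top _ hκ.lt_top
    have hfR : ∀ i, f (R i) = -(u i * (κ * f v)) := by
      intro i
      have h : f (R i + (u i * κ) • v) = 0 := hle (Submodule.subset_span ⟨i, rfl⟩)
      rw [map_add, map_smul, smul_eq_mul, mul_assoc] at h
      exact eq_neg_of_add_eq_zero_left h
    have hc : κ * f v ≠ 0 := by
      intro h
      exact hf (LinearMap.ext_on_range hR fun i => by simp [hfR, h])
    refine ⟨(LinearMap.toSpanSingleton D D (κ * f v)⁻¹).comp f, fun i => ?_, ?_⟩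
    · simp only [LinearMap.comp_apply, LinearMap.toSpanSingleton_apply, smul_eq_mul, hfR, neg_mul]
      rw [mul_inv_cancel_right₀ hc]
    · simp only [LinearMap.comp_apply, LinearMap.toSpanSingleton_apply, smul_eq_mul]
      rw [mul_inv_rev, mul_inv_cancel_left₀ (right_ne_zero_of_mul hc)]
  obtain ⟨f, hf, hfv⟩ := key hμ
  obtain ⟨g, hg, hgv⟩ := key hν
  have : f = g := LinearMap.ext_on_range hR fun i => by rw [hf, hg]
  exact inv_injective (by rw [← hfv, ← hgv, this])

end RankOnePerturbation

section RowRank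

variable {D : Type*} [DivisionRing D] {m n : ℕ}

theorem rowRank_eq_height_iff (A : Matrix (Fin m) (Fin n) D) :
    rowRank A = m ↔ LinearIndependent D fun i => A i := by
  rw [linearIndependent_iff_card_eq_finrank_span, Fintype.card_fin, eq_comm]
  rfl

theorem rowRank_eq_width_iff (A : Matrix (Fin m) (Fin n) D) :
    rowRank A = n ↔ Submodule.span D (Set.range fun i => A i) = ⊤ := by
  refine ⟨fun h => Submodule.eq_top_of_finrank_eq ?_, fun h => ?_⟩
  · rw [Module.finrank_fin_fun]
    exact h
  · rw [rowRank, h, finrank_top, Module.finrank_fin_fun]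

theorem eq_of_rowRank_add_ne_min {M N N' : Matrix (Fin m) (Fin n) D}
    (hM : rowRank M = min m n) (u : Fin m → D) (v : Fin n → D) {μ ν : D}
    (hN : ∀ i, N i = M i + (u i * μ) • v) (hN' : ∀ i, N' i = M i + (u i * ν) • v)
    (hμ : rowRank N ≠ min m n) (hν : rowRank N' ≠ min m n) : μ = ν := by
  rcases le_total m n with h | h
  · rw [min_eq_left h] at hM hμ hν
    rw [Ne, rowRank_eq_height_iff] at hμ hν
    simp only [hN] at hμ
    simp only [hN'] at hν
    exact eq_of_not_linearIndependent_add_smul ((rowRank_eq_height_iff M).1 hM) u v hμ hν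
  · rw [min_eq_right h] at hM hμ hν
    rw [Ne, rowRank_eq_width_iff] at hμ hν
    simp only [hN] at hμ
    simp only [hN'] at hν
    exact eq_of_span_range_add_smul_ne_top ((rowRank_eq_width_iff M).1 hM) u v hμ hν

theorem exists_rows_eq_smul_of_rowRank_eq_one {A : Matrix (Fin m) (Fin n) D}
    (hA : rowRank A = 1) : ∃ (u : Fin m → D) (v : Fin n → D), ∀ i, A i = u i • v := by
  obtain ⟨v, -, hv⟩ := finrank_eq_one_iff'.1 hA
  choose u hu using fun i => hv ⟨A i, Submodule.subset_span ⟨i, rfl⟩⟩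
  exact ⟨u, v, fun i => (congrArg Subtype.val (hu i)).symm⟩

theorem rowRank_zero : rowRank (0 : Matrix (Fin m) (Fin n) D) = 0 := by
  have h : Submodule.span D (Set.range fun i => (0 : Matrix (Fin m) (Fin n) D) i) = ⊥ := by
    rw [Submodule.span_eq_bot]
    rintro _ ⟨i, rfl⟩
    rfl
  rw [rowRank, h, finrank_bot]

end RowRank

theorem exists_ne_zero_ne_one_of_card_ne_two {D : Type*} [DivisionRing D]
    (hD : Nat.card D ≠ 2) : ∃ c : D, c ≠ 0 ∧ c ≠ 1 := by
  by_contra! h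
  refine hD (Nat.card_eq_two_iff.2 ⟨0, 1, zero_ne_one, Set.eq_univ_of_forall fun c => ?_⟩)
  by_cases hc : c = 0
  · exact Or.inl hc
  · exact Or.inr (h c hc)

/-- condition (A5) for the graph on rectangular matrices over a
division ring with more than two elements (graph distance = rank of the
difference, diameter = min{m,n}). -/
theorem stmt_6 {D : Type*} [DivisionRing D] (hD : Nat.card D ≠ 2)
    {m n : ℕ} (hm : 2 ≤ m) (hn : 2 ≤ n)
    (A B : Matrix (Fin m) (Fin n) D) (hAB : rowRank (A - B) = 1) :
    ∃ P : Matrix (Fin m) (Fin n) D, P ≠ A ∧ P ≠ B ∧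
      ∀ X : Matrix (Fin m) (Fin n) D, rowRank (X - P) = min m n →
        rowRank (X - A) = min m n ∨ rowRank (X - B) = min m n := by
  obtain ⟨c, hc0, hc1⟩ := exists_ne_zero_ne_one_of_card_ne_two hD
  obtain ⟨u, v, huv⟩ := exists_rows_eq_smul_of_rowRank_eq_one hAB
  have hB : ∀ i, B i = A i - u i • v := fun i => by
    rw [← huv i]
    exact (sub_sub_cancel (A i) (B i)).symm
  have hne : A - B ≠ 0 := by
    intro h
    rw [h, rowRank_zero] at hAB
    exact zero_ne_one hAB
  obtain ⟨i, hi⟩ : ∃ i, u i • v ≠ 0 := by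
    by_contra! h
    exact hne (funext fun i => (huv i).trans (h i))
  obtain ⟨hui, hv⟩ := smul_ne_zero_iff.1 hi
  refine ⟨fun i => A i - (u i * c) • v, fun h => ?_, fun h => ?_, fun X hX => ?_⟩
  · exact smul_ne_zero (mul_ne_zero hui hc0) hv (sub_eq_self.1 (congrFun h i))
  · have h' := (congrFun h i).trans (hB i)
    exact hc1 (mul_eq_left₀ hui |>.1 (smul_left_injective D hv (sub_right_injective h')))
  · by_contra! h
    have hPA : ∀ i, (X - A) i = X i - (A i - (u i * c) • v) + (u i * -c) • v := fun i => by
      rw [mul_neg, neg_smul]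
      change X i - A i = _
      abel
    have hPB : ∀ i, (X - B) i = X i - (A i - (u i * c) • v) + (u i * (1 - c)) • v := fun i => by
      rw [mul_sub, sub_smul, mul_one]
      change X i - B i = _
      rw [hB]
      abel
    have := eq_of_rowRank_add_ne_min hX u v hPA hPB h.1 h.2
    rw [sub_eq_add_neg, right_eq_add] at this
    exact one_ne_zero this
end

section
/- Let D, D' be division rings with |D| ≠ 2 and |D'| ≠ 2, and let m, n, p, q be integers ≥ 2. If φ : M_{m×n}(D) → M_{p×q}(D') is a surjection satisfying, for all A, B ∈ M_{m×n}(D), rank(A − B) = min{m,n} if and only if rank(A^φ − B^φ) = min{p,q}, then φ is bijective, both φ and φ⁻¹ preserve adjacency of matrices (i.e. rank(A − B) = 1 if and only if rank(A^φ − B^φ) = 1), and min{m,n} = min{p,q}. -/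
open Module Matrix

section RowRank

variable {D : Type*} [DivisionRing D] {m n : ℕ}

theorem rowRank_le_iff_exists_mul {A : Matrix (Fin m) (Fin n) D} {k : ℕ} :
    rowRank A ≤ k ↔
      ∃ (B : Matrix (Fin m) (Fin k) D) (C : Matrix (Fin k) (Fin n) D), A = B * C := by
  constructor
  · intro h
    set S := Submodule.span D (Set.range fun i => A i)
    let b := finBasis D S
    have hA : ∀ i, A i ∈ S := fun i => Submodule.subset_span ⟨i, rfl⟩
    let e : Fin (finrank D S) → Fin k := Fin.castLE h
    have he : Function.Injective e := Fin.castLE_injective h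
    refine ⟨of fun i => Function.extend e (b.repr ⟨A i, hA i⟩) 0,
      of (Function.extend e (fun l => (b l : Fin n → D)) 0), ?_⟩
    ext i j
    have h1 := congrArg (fun x : S => (x : Fin n → D) j) (b.sum_repr ⟨A i, hA i⟩)
    simp only [Submodule.coe_sum, Submodule.coe_smul, Finset.sum_apply, Pi.smul_apply,
      smul_eq_mul] at h1
    rw [mul_apply, ← h1]
    simp only [of_apply]
    refine Finset.sum_of_injOn e he.injOn (by simp) ?_ ?_
    · intro l _ hl
      have : ¬ ∃ a, e a = l := by simpa using hl
      simp [Function.extend_apply' _ _ _ this]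
    · intro l _
      rw [he.extend_apply, he.extend_apply]
  · rintro ⟨B, C, rfl⟩
    have hle : Submodule.span D (Set.range fun i => (B * C) i) ≤
        Submodule.span D (Set.range fun l => C l) := by
      rw [Submodule.span_le]
      rintro _ ⟨i, rfl⟩
      have : (B * C) i = ∑ l, B i l • C l := by
        ext j
        simp [mul_apply]
      simp only [this, SetLike.mem_coe]
      exact Submodule.sum_mem _ fun l _ =>
        Submodule.smul_mem _ _ (Submodule.subset_span ⟨l, rfl⟩)
    calc rowRank (B * C) ≤ finrank D (Submodule.span D (Set.range fun l => C l)) :=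
          Submodule.finrank_mono hle
      _ ≤ k := (finrank_range_le_card (R := D) fun l => C l).trans_eq (Fintype.card_fin k)

/-- Transposition, as an additive equivalence with the matrices over the opposite ring. -/
def opTranspose (D : Type*) [DivisionRing D] (m n : ℕ) :
    Matrix (Fin m) (Fin n) D ≃+ Matrix (Fin n) (Fin m) Dᵐᵒᵖ where
  toFun A := (A.map MulOpposite.op)ᵀ
  invFun A := Aᵀ.map MulOpposite.unop
  left_inv _ := rfl
  right_inv _ := rfl
  map_add' _ _ := rfl

@[simp]
theorem opTranspose_apply (A : Matrix (Fin m) (Fin n) D) (i : Fin n) (j : Fin m) :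
    opTranspose D m n A i j = MulOpposite.op (A j i) := rfl

@[simp]
theorem rowRank_opTranspose (A : Matrix (Fin m) (Fin n) D) :
    rowRank (opTranspose D m n A) = rowRank A := by
  apply le_antisymm
  · obtain ⟨B, C, h⟩ := rowRank_le_iff_exists_mul.1 (le_refl (rowRank A))
    refine rowRank_le_iff_exists_mul.2 ⟨opTranspose D _ _ C, opTranspose D _ _ B, ?_⟩
    ext i j
    have hij := congrFun (congrFun h j) i
    simp [hij, mul_apply]
  · obtain ⟨B, C, h⟩ := rowRank_le_iff_exists_mul.1 (le_refl (rowRank (opTranspose D m n A)))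
    refine rowRank_le_iff_exists_mul.2
      ⟨Cᵀ.map MulOpposite.unop, Bᵀ.map MulOpposite.unop, ?_⟩
    ext i j
    apply MulOpposite.op_injective
    have hij := congrFun (congrFun h j) i
    rw [opTranspose_apply] at hij
    simp [hij, mul_apply]

theorem rowRank_eq_zero {A : Matrix (Fin m) (Fin n) D} : rowRank A = 0 ↔ A = 0 := by
  rw [rowRank, Submodule.finrank_eq_zero, Submodule.span_eq_bot]
  exact ⟨fun h => funext fun i => h _ ⟨i, rfl⟩, by rintro rfl _ ⟨i, rfl⟩; rfl⟩

theorem rowRank_le_one_iff {A : Matrix (Fin m) (Fin n) D} :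
    rowRank A ≤ 1 ↔ ∃ u v, A = vecMulVec u v := by
  rw [rowRank_le_iff_exists_mul]
  constructor
  · rintro ⟨B, C, rfl⟩
    refine ⟨fun i => B i 0, C 0, ?_⟩
    ext i j
    simp [mul_apply, vecMulVec_apply]
  · rintro ⟨u, v, rfl⟩
    refine ⟨of fun i _ => u i, of fun _ => v, ?_⟩
    ext i j
    simp [mul_apply, vecMulVec_apply]

theorem exists_rowRank_sub_le {A : Matrix (Fin m) (Fin n) D} {k : ℕ} (h : rowRank A ≤ k + 1) :
    ∃ B, rowRank B ≤ 1 ∧ rowRank (A - B) ≤ k := by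
  obtain ⟨B, C, rfl⟩ := rowRank_le_iff_exists_mul.1 h
  refine ⟨vecMulVec (fun i => B i 0) (C 0), rowRank_le_one_iff.2 ⟨_, _, rfl⟩,
    rowRank_le_iff_exists_mul.2 ⟨of fun i l => B i l.succ, of fun l => C l.succ, ?_⟩⟩
  ext i j
  simp [mul_apply, vecMulVec_apply, Fin.sum_univ_succ]

theorem rowRank_add_le (A B : Matrix (Fin m) (Fin n) D) :
    rowRank (A + B) ≤ rowRank A + rowRank B := by
  refine (Submodule.finrank_mono ?_).trans (Submodule.finrank_add_le_finrank_add_finrank _ _)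
  rw [Submodule.span_le]
  rintro _ ⟨i, rfl⟩
  exact Submodule.add_mem_sup (Submodule.subset_span ⟨i, rfl⟩) (Submodule.subset_span ⟨i, rfl⟩)

theorem rowRank_eq_card_rows_iff {A : Matrix (Fin m) (Fin n) D} :
    rowRank A = m ↔ ∀ w, w ᵥ* A = 0 → w = 0 := by
  have h1 : rowRank A = finrank D (LinearMap.range A.vecMulLinear) := by
    rw [range_vecMulLinear]
    rfl
  have h2 := A.vecMulLinear.finrank_range_add_finrank_ker
  rw [finrank_fin_fun] at h2
  have h3 : (∀ w, w ᵥ* A = 0 → w = 0) ↔ LinearMap.ker A.vecMulLinear = ⊥ := by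
    rw [LinearMap.ker_eq_bot']
    rfl
  rw [h3, ← Submodule.finrank_eq_zero]
  omega

theorem exists_rowRank_eq_of_linearIndependent (h : m ≤ n) {k : ℕ} {w : Fin k → Fin m → D}
    {y : Fin k → Fin n → D} (hw : LinearIndependent D w) (hy : LinearIndependent D y) :
    ∃ X : Matrix (Fin m) (Fin n) D, rowRank X = m ∧ ∀ i, w i ᵥ* X = y i := by
  let f : (Fin m → D) →ₗ[D] (Fin n → D) := Function.ExtendByZero.linearMap D (Fin.castLE h)
  have hf : Function.Injective f := by
    intro a b hab
    funext i
    have := congrFun hab (Fin.castLE h i)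
    simpa [f, (Fin.castLE_injective h).extend_apply] using this
  have hfw : LinearIndependent D (f ∘ w) := hw.map' f (LinearMap.ker_eq_bot.2 hf)
  obtain ⟨g, hg⟩ := Submodule.exists_linearEquiv_restrict_eq
    ((Basis.span hfw).equiv (Basis.span hy) (Equiv.refl _))
  have key : ∀ x, x ᵥ* LinearMap.toMatrixRight' (g.toLinearMap ∘ₗ f) = g (f x) := fun x =>
    LinearMap.congr_fun (LinearMap.toMatrixRight'.symm_apply_apply (g.toLinearMap ∘ₗ f)) x
  refine ⟨LinearMap.toMatrixRight' (g.toLinearMap ∘ₗ f), rowRank_eq_card_rows_iff.2 ?_, ?_⟩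
  · intro x hx
    rw [key] at hx
    exact hf (g.injective (by simpa using hx))
  · intro i
    rw [key]
    have := hg (Basis.span hfw i)
    rw [Basis.equiv_apply, Basis.span_apply, Basis.span_apply] at this
    exact this.symm

theorem rowRank_sub_ne_of_vecMul_eq {X A : Matrix (Fin m) (Fin n) D} {w : Fin m → D}
    (hw : w ≠ 0) (h : w ᵥ* X = w ᵥ* A) : rowRank (X - A) ≠ m := fun h' =>
  hw (rowRank_eq_card_rows_iff.1 h' w (by rw [vecMul_sub, h, sub_self]))

theorem exists_vecMul_ne_zero {A : Matrix (Fin m) (Fin n) D} (hA : A ≠ 0) :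
    ∃ w, w ᵥ* A ≠ 0 := by
  by_contra! h
  exact hA (Matrix.ext_of_single_vecMul fun i => by simp [h])

theorem exists_rowRank_eq_and_rowRank_sub_ne (h : m ≤ n) {A : Matrix (Fin m) (Fin n) D}
    (hA : A ≠ 0) : ∃ X : Matrix (Fin m) (Fin n) D, rowRank X = m ∧ rowRank (X - A) ≠ m := by
  obtain ⟨w, hw⟩ := exists_vecMul_ne_zero hA
  have hw0 : w ≠ 0 := by
    rintro rfl
    simp at hw
  obtain ⟨X, hX, hXw⟩ := exists_rowRank_eq_of_linearIndependent h (w := ![w]) (y := ![w ᵥ* A])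
    (.of_subsingleton 0 hw0) (.of_subsingleton 0 hw)
  exact ⟨X, hX, rowRank_sub_ne_of_vecMul_eq hw0 (hXw 0)⟩

/-- The complement of a proper subspace spans the whole space. -/
theorem vecMul_mem_of_forall_notMem {A : Matrix (Fin m) (Fin n) D} {U : Submodule D (Fin m → D)}
    {L : Submodule D (Fin n → D)} (hU : U ≠ ⊤) (h : ∀ w ∉ U, w ᵥ* A ∈ L) (w : Fin m → D) :
    w ᵥ* A ∈ L := by
  by_cases hw : w ∈ U
  · obtain ⟨z, -, hz⟩ := SetLike.exists_of_lt hU.lt_top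
    have h1 := L.sub_mem (h (w + z) fun hwz => hz ((U.add_mem_iff_right hw).1 hwz)) (h z hz)
    rwa [add_vecMul, add_sub_cancel_right] at h1
  · exact h w hw

theorem span_singleton_ne_top (hm : 2 ≤ m) (w : Fin m → D) :
    Submodule.span D {w} ≠ ⊤ := by
  intro h
  have h1 := finrank_span_le_card (R := D) ({w} : Set (Fin m → D))
  rw [h, finrank_top, finrank_fin_fun] at h1
  simp at h1
  omega

theorem linearIndependent_pair_of_notMem_span {V : Type*} [AddCommGroup V] [Module D V] {x y : V}
    (hx : x ≠ 0) (hy : y ∉ Submodule.span D {x}) : LinearIndependent D ![x, y] := by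
  rw [LinearIndependent.pair_iff' hx]
  exact fun a ha => hy (Submodule.mem_span_singleton.2 ⟨a, ha⟩)

/-- If no matrix of full row rank simultaneously agrees with `A` and with `B` on nonzero
vectors, then the row space of `A` lies in every line spanned by some `w' ᵥ* B`. -/
theorem vecMul_mem_span_of_forall (h : m ≤ n) (hm : 2 ≤ m) {A B : Matrix (Fin m) (Fin n) D}
    (hAB : ∀ X : Matrix (Fin m) (Fin n) D, rowRank X = m →
      rowRank (X - A) = m ∨ rowRank (X - B) = m)
    {w' : Fin m → D} (hw' : w' ᵥ* B ≠ 0) (w : Fin m → D) :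
    w ᵥ* A ∈ Submodule.span D {w' ᵥ* B} := by
  have hw'_ne : w' ≠ 0 := by
    rintro rfl
    simp at hw'
  refine vecMul_mem_of_forall_notMem (span_singleton_ne_top hm w') (fun w hw => ?_) w
  by_contra hwA
  have hw_pair : LinearIndependent D ![w', w] := linearIndependent_pair_of_notMem_span hw'_ne hw
  have hy_pair : LinearIndependent D ![w' ᵥ* B, w ᵥ* A] :=
    linearIndependent_pair_of_notMem_span hw' hwA
  obtain ⟨X, hX, hXw⟩ := exists_rowRank_eq_of_linearIndependent h hw_pair hy_pair
  have hw0 : w ≠ 0 := by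
    rintro rfl
    simp at hw
  have hA : w ᵥ* X = w ᵥ* A := hXw 1
  have hB : w' ᵥ* X = w' ᵥ* B := hXw 0
  exact (hAB X hX).elim (rowRank_sub_ne_of_vecMul_eq hw0 hA)
    (rowRank_sub_ne_of_vecMul_eq hw'_ne hB)

theorem rowRank_sub_le_one_of_forall (h : m ≤ n) (hm : 2 ≤ m) {A B : Matrix (Fin m) (Fin n) D}
    (hA : A ≠ 0) (hB : B ≠ 0)
    (hAB : ∀ X : Matrix (Fin m) (Fin n) D, rowRank X = m →
      rowRank (X - A) = m ∨ rowRank (X - B) = m) : rowRank (A - B) ≤ 1 := by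
  obtain ⟨w, hw⟩ := exists_vecMul_ne_zero hA
  obtain ⟨w', hw'⟩ := exists_vecMul_ne_zero hB
  set L := Submodule.span D {w' ᵥ* B}
  have hAL : ∀ x, x ᵥ* A ∈ L := vecMul_mem_span_of_forall h hm hAB hw'
  have hBL : ∀ x, x ᵥ* B ∈ L := fun x =>
    (Submodule.span_singleton_le_iff_mem _ _).2 (hAL w)
      (vecMul_mem_span_of_forall h hm (fun X hX => (hAB X hX).symm) hw x)
  calc rowRank (A - B) ≤ finrank D L := by
        refine Submodule.finrank_mono (Submodule.span_le.2 ?_)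
        rintro _ ⟨i, rfl⟩
        have := L.sub_mem (hAL (Pi.single i 1)) (hBL (Pi.single i 1))
        rwa [single_one_vecMul, single_one_vecMul] at this
    _ ≤ 1 := by simpa using finrank_span_le_card (R := D) ({w' ᵥ* B} : Set (Fin n → D))

/-- Among the matrices `Y + u (c v)`, at most one fails to have full row rank. -/
theorem rowRank_add_vecMulVec_eq_or {Y : Matrix (Fin m) (Fin n) D} (hY : rowRank Y = m)
    (u : Fin m → D) (v : Fin n → D) {a b : D} (hab : a ≠ b) :
    rowRank (Y + vecMulVec u (a • v)) = m ∨ rowRank (Y + vecMulVec u (b • v)) = m := by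
  rw [rowRank_eq_card_rows_iff] at hY
  have key : ∀ c : D, rowRank (Y + vecMulVec u (c • v)) ≠ m →
      ∃ w, w ᵥ* Y = -(c • v) ∧ w ⬝ᵥ u = 1 := by
    intro c hc
    rw [Ne, rowRank_eq_card_rows_iff] at hc
    push Not at hc
    obtain ⟨w, hw, hw0⟩ := hc
    rw [vecMul_add, vecMul_vecMulVec] at hw
    have hu : w ⬝ᵥ u ≠ 0 := fun hu => hw0 (hY w (by simpa [hu] using hw))
    refine ⟨(w ⬝ᵥ u)⁻¹ • w, ?_, ?_⟩
    · rw [smul_vecMul, eq_neg_of_add_eq_zero_left hw, smul_neg, inv_smul_smul₀ hu]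
    · rw [smul_dotProduct, smul_eq_mul, inv_mul_cancel₀ hu]
  by_contra! hcon
  obtain ⟨w₁, h₁, h₁'⟩ := key a hcon.1
  obtain ⟨w₂, h₂, h₂'⟩ := key b hcon.2
  have main : ∀ {a b : D} {w₁ w₂ : Fin m → D}, a ≠ 0 → w₁ ᵥ* Y = -(a • v) → w₁ ⬝ᵥ u = 1 →
      w₂ ᵥ* Y = -(b • v) → w₂ ⬝ᵥ u = 1 → a = b := by
    intro a b w₁ w₂ ha h₁ h₁' h₂ h₂'
    have h3 : w₂ - (b * a⁻¹) • w₁ = 0 := hY _ (by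
      rw [sub_vecMul, smul_vecMul, h₁, h₂, smul_neg, smul_smul, inv_mul_cancel_right₀ ha,
        sub_self])
    have h4 := congrArg (· ⬝ᵥ u) h3
    simp only [sub_dotProduct, smul_dotProduct, h₁', h₂', zero_dotProduct, smul_eq_mul,
      mul_one, sub_eq_zero] at h4
    rw [eq_mul_inv_iff_mul_eq₀ ha, one_mul] at h4
    exact h4
  by_cases ha : a = 0
  · exact hab (main (ha ▸ hab.symm) h₂ h₂' h₁ h₁').symm
  · exact hab (main ha h₁ h₁' h₂ h₂')

theorem exists_ne_zero_ne_one (hD : Nat.card D ≠ 2) : ∃ a : D, a ≠ 0 ∧ a ≠ 1 := by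
  by_contra! h
  refine hD ?_
  rw [Nat.card_eq_two_iff]
  refine ⟨0, 1, zero_ne_one, Set.eq_univ_of_forall fun a => ?_⟩
  by_cases ha : a = 0
  · simp [ha]
  · simp [h a ha]

theorem rowRank_sub_eq_one_iff_of_le (hD : Nat.card D ≠ 2) (h : m ≤ n) (hm : 2 ≤ m)
    (A B : Matrix (Fin m) (Fin n) D) :
    rowRank (A - B) = 1 ↔ A ≠ B ∧ ∃ C, C ≠ A ∧ C ≠ B ∧
      ∀ X, rowRank (X - C) = m → rowRank (X - A) = m ∨ rowRank (X - B) = m := by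
  constructor
  · intro h1
    have hAB : A - B ≠ 0 := fun h0 => by simp [rowRank_eq_zero.2 h0] at h1
    obtain ⟨u, v, huv⟩ := rowRank_le_one_iff.1 h1.le
    obtain ⟨a, ha0, ha1⟩ := exists_ne_zero_ne_one hD
    have hne : ∀ c : D, c ≠ 0 → vecMulVec u (c • v) ≠ 0 := by
      intro c hc h0
      rw [huv] at hAB
      refine hAB (Matrix.ext fun i j => ?_)
      have hij := congrFun (congrFun h0 i) j
      simpa [vecMulVec_apply, hc] using hij
    have hA : A = B + vecMulVec u v := by rw [← huv]; abel
    have hsub : vecMulVec u ((a - 1) • v) = vecMulVec u (a • v) - vecMulVec u v := by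
      rw [sub_smul, one_smul, vecMulVec_sub]
    refine ⟨sub_ne_zero.1 hAB, B + vecMulVec u (a • v), ?_, ?_, fun X hX => ?_⟩
    · rw [hA, Ne, ← sub_eq_zero, add_sub_add_left_eq_sub, ← hsub]
      exact hne _ (sub_ne_zero.2 ha1)
    · simpa using hne a ha0
    · have := rowRank_add_vecMulVec_eq_or hX u v (a := a - 1) (b := a) (by simp)
      rw [hsub] at this
      convert this using 3
      · rw [hA]; abel
      · abel
  · rintro ⟨hAB, C, hCA, hCB, hC⟩
    have h1 := rowRank_sub_le_one_of_forall h hm (sub_ne_zero.2 hCA.symm) (sub_ne_zero.2 hCB.symm)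
      (fun X hX => by
        have := hC (X + C) (by rwa [add_sub_cancel_right])
        rwa [← sub_sub_eq_add_sub, ← sub_sub_eq_add_sub] at this)
    rw [sub_sub_sub_cancel_right] at h1
    have h2 : rowRank (A - B) ≠ 0 := by rwa [Ne, rowRank_eq_zero, sub_eq_zero]
    omega

theorem rowRank_sub_eq_one_iff (hD : Nat.card D ≠ 2) (hm : 2 ≤ m) (hn : 2 ≤ n)
    (A B : Matrix (Fin m) (Fin n) D) :
    rowRank (A - B) = 1 ↔ A ≠ B ∧ ∃ C, C ≠ A ∧ C ≠ B ∧
      ∀ X, rowRank (X - C) = min m n →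
        rowRank (X - A) = min m n ∨ rowRank (X - B) = min m n := by
  rcases le_total m n with h | h
  · rw [min_eq_left h]
    exact rowRank_sub_eq_one_iff_of_le hD h hm A B
  · rw [min_eq_right h]
    have hop : Nat.card Dᵐᵒᵖ ≠ 2 := by rwa [Nat.card_congr MulOpposite.opEquiv.symm]
    have := rowRank_sub_eq_one_iff_of_le hop h hn (opTranspose D m n A) (opTranspose D m n B)
    simpa only [← (opTranspose D m n).surjective.exists, ← (opTranspose D m n).surjective.forall,
      (opTranspose D m n).surjective.exists, (opTranspose D m n).surjective.forall, ← map_sub,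
      rowRank_opTranspose, ne_eq, (opTranspose D m n).injective.eq_iff] using this

theorem exists_rowRank_sub_eq_and_ne {A B : Matrix (Fin m) (Fin n) D} (hAB : A ≠ B) :
    ∃ X, rowRank (X - A) = min m n ∧ rowRank (X - B) ≠ min m n := by
  have hBA := sub_ne_zero.2 hAB.symm
  suffices ∃ X, rowRank X = min m n ∧ rowRank (X - (B - A)) ≠ min m n by
    obtain ⟨X, h₁, h₂⟩ := this
    exact ⟨X + A, by rwa [add_sub_cancel_right], by rwa [← sub_sub_eq_add_sub]⟩
  rcases le_total m n with h | h
  · rw [min_eq_left h]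
    exact exists_rowRank_eq_and_rowRank_sub_ne h hBA
  · rw [min_eq_right h]
    obtain ⟨X, h₁, h₂⟩ := exists_rowRank_eq_and_rowRank_sub_ne h
      ((map_ne_zero_iff _ (opTranspose D m n).injective).2 hBA)
    obtain ⟨X, rfl⟩ := (opTranspose D m n).surjective X
    rw [← map_sub, rowRank_opTranspose] at h₂
    exact ⟨X, by rwa [rowRank_opTranspose] at h₁, h₂⟩

theorem rowRank_le_min (A : Matrix (Fin m) (Fin n) D) : rowRank A ≤ min m n := by
  refine le_min ?_ ?_
  · exact (finrank_range_le_card (R := D) fun i => A i).trans_eq (Fintype.card_fin m)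
  · exact (Submodule.finrank_le _).trans_eq (finrank_fin_fun D)

theorem exists_rowRank_eq_min (D : Type*) [DivisionRing D] (hm : 2 ≤ m) (hn : 2 ≤ n) :
    ∃ A : Matrix (Fin m) (Fin n) D, rowRank A = min m n := by
  have hne : (0 : Matrix (Fin m) (Fin n) D) ≠ fun _ _ => 1 := fun h =>
    zero_ne_one (congrFun (congrFun h ⟨0, by omega⟩) ⟨0, by omega⟩)
  obtain ⟨X, hX, -⟩ := exists_rowRank_sub_eq_and_ne hne
  exact ⟨_, hX⟩

end RowRank

section Maps

variable {D D' : Type*} [DivisionRing D] [DivisionRing D'] {m n p q : ℕ}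

theorem rowRank_map_sub_le {φ : Matrix (Fin m) (Fin n) D → Matrix (Fin p) (Fin q) D'}
    (hφ : ∀ A B, rowRank (A - B) = 1 → rowRank (φ A - φ B) = 1)
    (A B : Matrix (Fin m) (Fin n) D) : rowRank (φ A - φ B) ≤ rowRank (A - B) := by
  suffices ∀ k A, rowRank (A - B) ≤ k → rowRank (φ A - φ B) ≤ k from this _ A le_rfl
  intro k
  induction k with
  | zero =>
    intro A hA
    obtain rfl := sub_eq_zero.1 (rowRank_eq_zero.1 (Nat.le_zero.1 hA))
    rw [rowRank_eq_zero.2 (sub_self _)]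
  | succ k ih =>
    intro A hA
    obtain ⟨C, hC, hAC⟩ := exists_rowRank_sub_le hA
    have h1 := ih (A - C) (by rwa [sub_right_comm])
    have h2 : rowRank (φ A - φ (A - C)) ≤ 1 := by
      rcases Nat.le_one_iff_eq_zero_or_eq_one.1 hC with h0 | h0
      · rw [rowRank_eq_zero.1 h0, sub_zero, rowRank_eq_zero.2 (sub_self _)]
        exact zero_le_one
      · exact (hφ _ _ (by rwa [sub_sub_cancel])).le
    have h3 := rowRank_add_le (φ A - φ (A - C)) (φ (A - C) - φ B)
    rw [sub_add_sub_cancel] at h3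
    omega

theorem min_le_min_of_rowRank_map_sub_le (hp : 2 ≤ p) (hq : 2 ≤ q)
    {φ : Matrix (Fin m) (Fin n) D → Matrix (Fin p) (Fin q) D'} (hsurj : Function.Surjective φ)
    (hφ : ∀ A B, rowRank (A - B) = 1 → rowRank (φ A - φ B) = 1) : min p q ≤ min m n := by
  obtain ⟨Y, hY⟩ := exists_rowRank_eq_min D' hp hq
  obtain ⟨A, rfl⟩ := hsurj Y
  obtain ⟨B, hB⟩ := hsurj 0
  have := rowRank_map_sub_le hφ A B
  rw [hB, sub_zero, hY] at this
  exact this.trans (rowRank_le_min _)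

end Maps

/-- Theorem 3.2 of the paper. A surjection between spaces of
rectangular matrices over division rings with more than two elements which
preserves pairs at maximal rank-distance in both directions is bijective,
preserves adjacency in both directions, and the diameters agree. -/
theorem stmt_7 {D D' : Type*} [DivisionRing D] [DivisionRing D']
    (hD : Nat.card D ≠ 2) (hD' : Nat.card D' ≠ 2)
    {m n p q : ℕ} (hm : 2 ≤ m) (hn : 2 ≤ n) (hp : 2 ≤ p) (hq : 2 ≤ q)
    (φ : Matrix (Fin m) (Fin n) D → Matrix (Fin p) (Fin q) D')
    (hsurj : Function.Surjective φ)
    (hdiam : ∀ A B : Matrix (Fin m) (Fin n) D,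
      rowRank (A - B) = min m n ↔ rowRank (φ A - φ B) = min p q) :
    Function.Bijective φ ∧
    (∀ A B : Matrix (Fin m) (Fin n) D,
      rowRank (A - B) = 1 ↔ rowRank (φ A - φ B) = 1) ∧
    min m n = min p q := by
  have hinj : Function.Injective φ := by
    intro A B hAB
    by_contra hne
    obtain ⟨X, h₁, h₂⟩ := exists_rowRank_sub_eq_and_ne hne
    exact h₂ ((hdiam X B).2 (hAB ▸ (hdiam X A).1 h₁))
  have hadj : ∀ A B, rowRank (A - B) = 1 ↔ rowRank (φ A - φ B) = 1 := by
    intro A B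
    rw [rowRank_sub_eq_one_iff hD hm hn, rowRank_sub_eq_one_iff hD' hp hq]
    simp only [hsurj.exists, hsurj.forall, hinj.ne_iff, hdiam]
  refine ⟨⟨hinj, hsurj⟩, hadj, le_antisymm ?_ ?_⟩
  · let e := Equiv.ofBijective φ ⟨hinj, hsurj⟩
    refine min_le_min_of_rowRank_map_sub_le hm hn e.symm.surjective fun A B hAB => ?_
    rw [hadj]
    have he : ∀ C, φ (e.symm C) = C := e.apply_symm_apply
    rwa [he, he]
  · exact min_le_min_of_rowRank_map_sub_le hp hq hsurj fun A B => (hadj A B).1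
end

section
/- Let D be a division ring with an involution σ satisfying (R1) and (R2), and n ≥ 2. Let A ∈ H_n(D) be a matrix with rank(A) = k + 1. Then a matrix B ∈ H_n(D) satisfies rank(B) = 1 and rank(A − B) = k if and only if there exists a row vector x ∈ D^n with x·A·σ(x)ᵗ ≠ 0 and B = σ(xA)ᵗ · (x·A·σ(x)ᵗ)⁻¹ · (xA), i.e. B is the n×n matrix whose (i,j) entry is σ((xA)_i) · (x·A·σ(x)ᵗ)⁻¹ · (xA)_j. -/
/-- The row rank of `A` is the dimension of the range of `x ↦ xA`. -/
theorem rowRank_eq_finrank_range_vecMulLinear {D : Type*} [DivisionRing D] {m n : ℕ}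
    (A : Matrix (Fin m) (Fin n) D) :
    rowRank A = Module.finrank D (LinearMap.range A.vecMulLinear) := by
  rw [range_vecMulLinear]
  rfl

/-- Rank-nullity for the row rank. -/
theorem rowRank_add_finrank_ker {D : Type*} [DivisionRing D] {m n : ℕ}
    (A : Matrix (Fin m) (Fin n) D) :
    rowRank A + Module.finrank D (LinearMap.ker A.vecMulLinear) = m := by
  rw [rowRank_eq_finrank_range_vecMulLinear, LinearMap.finrank_range_add_finrank_ker]
  simp

/-- For a Hermitian matrix `A`, `z σ(xA)ᵗ = z A σ(x)ᵗ`. -/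
theorem sum_mul_map_vecMul {D : Type*} [DivisionRing D] (σ : D → D)
    (hadd : ∀ x y : D, σ (x + y) = σ x + σ y)
    (hmul : ∀ x y : D, σ (x * y) = σ y * σ x)
    {n : ℕ} (A : Matrix (Fin n) (Fin n) D) (hA : ∀ i j, σ (A j i) = A i j)
    (z x : Fin n → D) :
    ∑ i, z i * σ (Matrix.vecMul x A i) = ∑ j, Matrix.vecMul z A j * σ (x j) := by
  have hsum : ∀ f : Fin n → D, σ (∑ i, f i) = ∑ i, σ (f i) := fun f =>
    map_sum (AddMonoidHom.mk' σ hadd) f Finset.univ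
  simp only [Matrix.vecMul, dotProduct, hsum, hmul, hA, Finset.mul_sum, Finset.sum_mul, mul_assoc]
  exact Finset.sum_comm

/-- Left multiplication of a row vector with a matrix of the form `b u`. -/
theorem vecMul_of_eq_mul {D : Type*} [DivisionRing D] {n : ℕ}
    {B : Matrix (Fin n) (Fin n) D} {b u : Fin n → D} (h : ∀ i j, B i j = b i * u j)
    (y : Fin n → D) : Matrix.vecMul y B = (∑ i, y i * b i) • u := by
  ext j
  simp [Matrix.vecMul, dotProduct, h, Finset.sum_mul, mul_assoc]

/-- Lemma 3.4 of the paper. `σ` is an involution of the division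
ring `D` (an anti-automorphism of order at most two), subject to the
restrictions (R1) and (R2). For a Hermitian matrix `A` of rank `k + 1`, a
Hermitian matrix `B` has rank `1` and `rank (A - B) = k` iff
`B = σ(xA)ᵗ (x A σ(x)ᵗ)⁻¹ (xA)` for some row vector `x` with `x A σ(x)ᵗ ≠ 0`. -/
theorem stmt_8 {D : Type*} [DivisionRing D] (σ : D → D)
    (hadd : ∀ x y : D, σ (x + y) = σ x + σ y)
    (hmul : ∀ x y : D, σ (x * y) = σ y * σ x)
    (hinv : ∀ x : D, σ (σ x) = x)
    -- (R1): the fixed elements of `σ` have more than three elements in common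
    -- with the centre of `D`
    (hR1 : ∃ s : Finset D, 3 < s.card ∧ ∀ x ∈ s, σ x = x ∧ x ∈ Subring.center D)
    -- (R2): if `σ` is the identity, the characteristic is not two
    (hR2 : σ = id → (2 : D) ≠ 0)
    {n : ℕ} (hn : 2 ≤ n) (k : ℕ)
    (A : Matrix (Fin n) (Fin n) D) (hA : ∀ i j, σ (A j i) = A i j)
    (hrkA : rowRank A = k + 1)
    (B : Matrix (Fin n) (Fin n) D) (hB : ∀ i j, σ (B j i) = B i j) :
    (rowRank B = 1 ∧ rowRank (A - B) = k) ↔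
      ∃ x : Fin n → D,
        (∑ j, Matrix.vecMul x A j * σ (x j)) ≠ 0 ∧
        ∀ i j, B i j = σ (Matrix.vecMul x A i) *
          (∑ l, Matrix.vecMul x A l * σ (x l))⁻¹ * Matrix.vecMul x A j := by
  constructor
  · rintro ⟨hB1, hABk⟩
    obtain ⟨x, hx, hxA⟩ : ∃ x ∈ LinearMap.ker (A - B).vecMulLinear,
        x ∉ LinearMap.ker A.vecMulLinear := by
      by_contra! h
      have h1 := Submodule.finrank_mono (show LinearMap.ker (A - B).vecMulLinear ≤ _ from h)
      have h2 := rowRank_add_finrank_ker A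
      have h3 := rowRank_add_finrank_ker (A - B)
      omega
    simp only [LinearMap.mem_ker, Matrix.vecMulLinear_apply, Matrix.vecMul_sub] at hx hxA
    have hxB : Matrix.vecMul x A = Matrix.vecMul x B := sub_eq_zero.mp hx
    set u := Matrix.vecMul x A with hu
    have huB : u ∈ LinearMap.range B.vecMulLinear := ⟨x, by simp [hxB]⟩
    rw [rowRank_eq_finrank_range_vecMulLinear] at hB1
    have hrow : ∀ i, ∃ c : D, c • u = B i := fun i => by
      obtain ⟨c, hc⟩ := (finrank_eq_one_iff_of_nonzero' (⟨u, huB⟩ : LinearMap.range B.vecMulLinear)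
        (by simpa [Subtype.ext_iff] using hxA)).mp hB1
        ⟨B i, Pi.single i 1, by ext j; simp [Matrix.row]⟩
      exact ⟨c, congrArg Subtype.val hc⟩
    choose b hb using hrow
    have hBb : ∀ i j, B i j = b i * u j := fun i j => by rw [← hb i]; rfl
    obtain ⟨p, hp⟩ := Function.ne_iff.mp hxA
    have hp' : u p ≠ 0 := hp
    set c := σ (b p) * (u p)⁻¹ with hc
    have hbc : ∀ i, b i = σ (u i) * c := fun i => by
      have := hB i p
      rw [hBb, hBb, hmul] at this
      rw [hc, ← mul_assoc, this, mul_inv_cancel_right₀ hp']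
    have hsc : (∑ l, u l * σ (x l)) * c = 1 := by
      have h1 := congrFun (hxB.trans (vecMul_of_eq_mul hBb x)) p
      rw [Pi.smul_apply, smul_eq_mul, eq_comm, mul_eq_right₀ hp'] at h1
      rw [← sum_mul_map_vecMul σ hadd hmul A hA x x, ← h1, Finset.sum_mul]
      exact Finset.sum_congr rfl fun i _ => by rw [hbc, mul_assoc]
    refine ⟨x, left_ne_zero_of_mul_eq_one hsc, fun i j => ?_⟩
    rw [hBb, hbc, eq_inv_of_mul_eq_one_right hsc]
  · rintro ⟨x, hs, hBx⟩
    set u := Matrix.vecMul x A with hu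
    set s := ∑ l, u l * σ (x l) with hs_def
    have hvB : ∀ y, Matrix.vecMul y B = ((∑ j, Matrix.vecMul y A j * σ (x j)) * s⁻¹) • u := by
      intro y
      rw [vecMul_of_eq_mul hBx y, ← sum_mul_map_vecMul σ hadd hmul A hA y x, Finset.sum_mul]
      simp only [mul_assoc, hu]
    have hxB : Matrix.vecMul x B = u := by
      rw [hvB, ← hu, ← hs_def, mul_inv_cancel₀ hs, one_smul]
    have hu0 : u ≠ 0 := by
      intro h
      exact hs (by simp [hs_def, h])
    have hx0 : x ≠ 0 := by
      rintro rfl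
      exact hu0 (by simp [hu])
    constructor
    · have hr : LinearMap.range B.vecMulLinear = Submodule.span D {u} := by
        apply le_antisymm
        · rintro _ ⟨y, rfl⟩
          exact Submodule.mem_span_singleton.mpr ⟨_, (hvB y).symm⟩
        · rw [Submodule.span_singleton_le_iff_mem]
          exact ⟨x, hxB⟩
      rw [rowRank_eq_finrank_range_vecMulLinear, hr, finrank_span_singleton hu0]
    · have hker : LinearMap.ker (A - B).vecMulLinear =
          LinearMap.ker A.vecMulLinear ⊔ Submodule.span D {x} := by
        apply le_antisymm
        · intro y hy
          simp only [LinearMap.mem_ker, Matrix.vecMulLinear_apply, Matrix.vecMul_sub,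
            sub_eq_zero] at hy
          rw [hvB] at hy
          set d := (∑ j, Matrix.vecMul y A j * σ (x j)) * s⁻¹
          refine Submodule.mem_sup.mpr ⟨y - d • x, ?_, d • x,
            Submodule.smul_mem _ _ (Submodule.mem_span_singleton_self x), sub_add_cancel _ _⟩
          rw [LinearMap.mem_ker, map_sub, map_smul, Matrix.vecMulLinear_apply,
            Matrix.vecMulLinear_apply, ← hu, hy, sub_self]
        · refine sup_le (fun z hz => ?_) ?_
          · simp only [LinearMap.mem_ker, Matrix.vecMulLinear_apply] at hz
            simp [hvB, hz]
          · rw [Submodule.span_singleton_le_iff_mem]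
            simp [hxB, ← hu]
      have hdisj : LinearMap.ker A.vecMulLinear ⊓ Submodule.span D {x} = ⊥ := by
        rw [← disjoint_iff, Submodule.disjoint_span_singleton' hx0]
        exact hu0
      have h1 := Submodule.finrank_sup_add_finrank_inf_eq
        (LinearMap.ker A.vecMulLinear) (Submodule.span D {x})
      rw [hdisj, ← hker, finrank_bot, finrank_span_singleton hx0] at h1
      have h2 := rowRank_add_finrank_ker A
      have h3 := rowRank_add_finrank_ker (A - B)
      omega
end

section
/- Let D be a division ring with an involution σ satisfying (R1) and (R2), and n ≥ 2. Let A, B ∈ H_n(D) be non-zero, and suppose there exists an invertible P ∈ GL_n(D) such that P·A·σ(P)ᵗ = diag(a₁, a₂, …, a_k, 0, …, 0) where k = rank(A), and P·B·σ(P)ᵗ has all entries outside its upper-left k×k block equal to zero. Then there exists a row vector x ∈ D^n such that x·A·σ(x)ᵗ ≠ 0 and x·B·σ(x)ᵗ ≠ 0. -/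
open Matrix in
/-- The row rank of `P * diagonal a * Q` is at most the number of non-zero
entries of `a`. -/
theorem rowRank_mul_diagonal_mul_le {D : Type*} [DivisionRing D] {n : ℕ}
    (P Q : Matrix (Fin n) (Fin n) D) (a : Fin n → D) (s : Finset (Fin n))
    (hs : ∀ i, a i ≠ 0 → i ∈ s) : rowRank (P * diagonal a * Q) ≤ s.card := by
  classical
  have hle : Submodule.span D (Set.range fun i => (P * diagonal a * Q) i) ≤
      Submodule.span D ((s.image fun j => Q j : Finset (Fin n → D)) : Set (Fin n → D)) := by
    rw [Submodule.span_le]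
    rintro _ ⟨i, rfl⟩
    have hrow : (P * diagonal a * Q) i = ∑ j, (P i j * a j) • Q j := by
      ext l
      rw [Matrix.mul_apply]
      simp [Matrix.mul_diagonal]
    simp only [hrow]
    refine Submodule.sum_mem _ fun j _ => ?_
    by_cases hj : a j = 0
    · simp [hj]
    · exact Submodule.smul_mem _ _ (Submodule.subset_span
        (Finset.mem_coe.2 (Finset.mem_image_of_mem _ (hs j hj))))
  exact (Submodule.finrank_mono hle).trans
    ((finrank_span_finset_le_card _).trans Finset.card_image_le)

open Matrix in
/-- The diagonal entries of a diagonalisation of `A` of the form `diag(a₁, …, a_k, 0, …, 0)` with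
`k = rowRank A` are non-zero in the first `k` places. -/
theorem ne_zero_of_lt_rowRank {D : Type*} [DivisionRing D] {n : ℕ}
    (P Q A : Matrix (Fin n) (Fin n) D) (a : Fin n → D) (hA : A = P * diagonal a * Q)
    (ha : ∀ i : Fin n, rowRank A ≤ (i : ℕ) → a i = 0) (i : Fin n) (hi : (i : ℕ) < rowRank A) :
    a i ≠ 0 := by
  classical
  intro h0
  set s : Finset (Fin n) := Finset.univ.filter fun j => a j ≠ 0 with hs
  have h1 : rowRank A ≤ s.card := by
    conv_lhs => rw [hA]
    exact rowRank_mul_diagonal_mul_le P Q a s (by simp [hs])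
  have h2 : s.image (fun j : Fin n => (j : ℕ)) ⊆ (Finset.range (rowRank A)).erase i := by
    intro m hm
    obtain ⟨j, hj, rfl⟩ := Finset.mem_image.1 hm
    have hj0 : a j ≠ 0 := by simpa [hs] using hj
    refine Finset.mem_erase.2 ⟨fun h => hj0 (Fin.ext h ▸ h0), Finset.mem_range.2 ?_⟩
    by_contra hlt
    exact hj0 (ha j (not_lt.1 hlt))
  have h3 := Finset.card_le_card h2
  rw [Finset.card_image_of_injective _ Fin.val_injective,
    Finset.card_erase_of_mem (Finset.mem_range.2 hi), Finset.card_range] at h3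
  omega

/-- Among more than three central elements, some non-zero one avoids the quadratic equation
`l * l * α + β = 0`, provided `β ≠ 0`. -/
theorem exists_mem_sq_mul_add_ne_zero {D : Type*} [DivisionRing D] (s : Finset D)
    (hcard : 3 < s.card) (hs : ∀ x ∈ s, x ∈ Subring.center D) (α β : D) (hβ : β ≠ 0) :
    ∃ l ∈ s, l ≠ 0 ∧ l * l * α + β ≠ 0 := by
  classical
  by_contra! h
  obtain ⟨m, hm, hm0⟩ : ∃ m ∈ s, m ≠ 0 := Finset.exists_mem_ne (by omega) 0
  have hα : α ≠ 0 := by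
    rintro rfl
    exact hβ (by simpa using h m hm hm0)
  have hsub : s ⊆ {0, m, -m} := by
    intro l hl
    by_cases hl0 : l = 0
    · simp [hl0]
    have hsq : l * l = m * m :=
      mul_right_cancel₀ hα (add_right_cancel ((h l hl hl0).trans (h m hm hm0).symm))
    have hcomm : Commute l m := (Subring.mem_center_iff.1 (hs m hm) l)
    rcases hcomm.mul_self_eq_mul_self_iff.1 hsq with hform | hform <;> simp [hform]
  have := (Finset.card_le_card hsub).trans Finset.card_le_three
  omega

open Matrix in
/-- A non-zero Hermitian matrix `B` supported on the support of a diagonal matrix has a common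
non-isotropic vector with it. -/
theorem exists_diagonal_form_ne_zero {D : Type*} [DivisionRing D] [StarRing D]
    (s : Finset D) (hcard : 3 < s.card) (hs : ∀ x ∈ s, star x = x ∧ x ∈ Subring.center D)
    (h2 : (∀ x : D, star x = x) → (2 : D) ≠ 0) {n : Type*} [Fintype n] [DecidableEq n]
    (a : n → D) (B : Matrix n n D) (hB : B.IsHermitian) (hB0 : B ≠ 0)
    (ha : ∀ i j, B i j ≠ 0 → a i ≠ 0) :
    ∃ y : n → D, (y ᵥ* diagonal a) ⬝ᵥ star y ≠ 0 ∧ (y ᵥ* B) ⬝ᵥ star y ≠ 0 := by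
  by_cases hdiag : ∃ i, B i i ≠ 0
  · obtain ⟨i, hi⟩ := hdiag
    refine ⟨Pi.single i 1, ?_, ?_⟩
    · simpa [← Pi.single_star] using ha i i hi
    · simpa [← Pi.single_star] using hi
  push Not at hdiag
  obtain ⟨i, j, hij⟩ : ∃ i j, B i j ≠ 0 := by
    by_contra! h
    exact hB0 (Matrix.ext h)
  have hne : i ≠ j := by
    rintro rfl
    exact hij (hdiag i)
  have hji : B j i = star (B i j) := (hB.apply j i).symm
  have haj : a j ≠ 0 := ha j i (by simpa [hji] using hij)
  obtain ⟨z, hz⟩ : ∃ z : D, z + star z ≠ 0 := by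
    by_contra! h
    have h1 : (2 : D) = 0 := by simpa [one_add_one_eq_two] using h 1
    refine h2 (fun x => ?_) h1
    have hx : x + x = 0 := by rw [← two_mul, h1, zero_mul]
    exact add_left_cancel ((h x).trans hx.symm)
  obtain ⟨c, hcb⟩ : ∃ c, c * B i j = z := ⟨z * (B i j)⁻¹, inv_mul_cancel_right₀ hij z⟩
  obtain ⟨l, hl, hl0, hlα⟩ := exists_mem_sq_mul_add_ne_zero s hcard (fun x hx => (hs x hx).2)
    (c * a i * star c) (a j) haj
  have hls := (hs l hl).1
  have hlc := Subring.mem_center_iff.1 (hs l hl).2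
  refine ⟨Pi.single i (l * c) + Pi.single j 1, ?_, ?_⟩
  · have : l * c * a i * (star c * l) = l * l * (c * a i * star c) := by
      rw [← mul_assoc, hlc]
      simp only [mul_assoc]
    rw [← this] at hlα
    simpa [← Pi.single_star, add_vecMul, hne, hne.symm, hls] using hlα
  · have : l * c * B i j + B j i * (star c * l) = l * (z + star z) := by
      rw [hji, ← mul_assoc (star _), ← star_mul, hcb, hlc, mul_assoc, hcb, mul_add]
    have hform := mul_ne_zero hl0 hz
    rw [← this] at hform
    simpa [← Pi.single_star, add_vecMul, hdiag, hls, add_comm] using hform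

/-- Lemma 3.5 of the paper. If `A, B` are non-zero Hermitian
matrices and some `P ∈ GL_n(D)` takes `A` to `diag(a₁,…,a_k,0,…,0)` (with
`k = rank A`) and `B` to a matrix supported on the upper-left `k × k` block
under the congruence `X ↦ P X σ(P)ᵗ`, then there is a row vector `x` with
`x A σ(x)ᵗ ≠ 0` and `x B σ(x)ᵗ ≠ 0`. -/
theorem stmt_9 {D : Type*} [DivisionRing D] (σ : D → D)
    (hadd : ∀ x y : D, σ (x + y) = σ x + σ y)
    (hmul : ∀ x y : D, σ (x * y) = σ y * σ x)
    (hinv : ∀ x : D, σ (σ x) = x)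
    (hR1 : ∃ s : Finset D, 3 < s.card ∧ ∀ x ∈ s, σ x = x ∧ x ∈ Subring.center D)
    (hR2 : σ = id → (2 : D) ≠ 0)
    {n : ℕ} (hn : 2 ≤ n)
    (A B : Matrix (Fin n) (Fin n) D)
    (hA : ∀ i j, σ (A j i) = A i j) (hB : ∀ i j, σ (B j i) = B i j)
    (hA0 : A ≠ 0) (hB0 : B ≠ 0)
    (hP : ∃ P : Matrix (Fin n) (Fin n) D, IsUnit P ∧
      (∃ a : Fin n → D,
        P * A * (Matrix.of fun i j => σ (P j i)) = Matrix.diagonal a ∧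
        ∀ i : Fin n, rowRank A ≤ (i : ℕ) → a i = 0) ∧
      (∀ i j : Fin n, rowRank A ≤ (i : ℕ) ∨ rowRank A ≤ (j : ℕ) →
        (P * B * (Matrix.of fun i j => σ (P j i))) i j = 0)) :
    ∃ x : Fin n → D,
      (∑ j, Matrix.vecMul x A j * σ (x j)) ≠ 0 ∧
      (∑ j, Matrix.vecMul x B j * σ (x j)) ≠ 0 := by
  let _ : StarRing D :=
    { star := σ, star_involutive := hinv, star_mul := hmul, star_add := hadd }
  obtain ⟨s, hcard, hs⟩ := hR1
  obtain ⟨P, hPu, ⟨a, hPA, ha⟩, hPB⟩ := hP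
  have hstar : (Matrix.of fun i j => σ (P j i)) = P.conjTranspose := rfl
  rw [hstar] at hPA hPB
  obtain ⟨R, hPR, hRP⟩ := isUnit_iff_exists.1 hPu
  have hPRstar : P.conjTranspose * R.conjTranspose = 1 := by
    rw [← Matrix.conjTranspose_mul, hRP, Matrix.conjTranspose_one]
  have hback (M : Matrix (Fin n) (Fin n) D) :
      R * (P * M * P.conjTranspose) * R.conjTranspose = M := by
    rw [← mul_assoc, ← mul_assoc, hRP, one_mul, mul_assoc, hPRstar, mul_one]
  have hane := ne_zero_of_lt_rowRank R R.conjTranspose A a (by rw [← hPA, hback]) ha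
  have hBh : B.IsHermitian := Matrix.ext hB
  obtain ⟨y, hyA, hyB⟩ := exists_diagonal_form_ne_zero s hcard hs (fun h => hR2 (funext h)) a
    (P * B * P.conjTranspose) (Matrix.isHermitian_mul_mul_conjTranspose P hBh)
    (fun h => hB0 (by rw [← hback B, h, mul_zero, zero_mul]))
    (fun i j hij => hane i (not_le.1 fun hi => hij (hPB i j (Or.inl hi))))
  have hform (M : Matrix (Fin n) (Fin n) D) :
      Matrix.vecMul y (P * M * P.conjTranspose) ⬝ᵥ star y =
        ∑ j, Matrix.vecMul (Matrix.vecMul y P) M j * σ (Matrix.vecMul y P j) := by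
    rw [← Matrix.vecMul_vecMul, ← Matrix.vecMul_vecMul, ← Matrix.dotProduct_mulVec,
      ← Matrix.star_vecMul]
    rfl
  rw [← hPA, hform] at hyA
  rw [hform] at hyB
  exact ⟨Matrix.vecMul y P, hyA, hyB⟩
end

section
/- Let D be a division ring with an involution σ satisfying (R1) and (R2), and n ≥ 2. For any X, Y, Z ∈ H_n(D) with X ≠ Y and rank(X − Z) = rank(Y − Z) = n, there exists W ∈ H_n(D) with rank(Z − W) = 1, rank(X − W) = n − 1, and rank(Y − W) = n. (This is condition (A4) for the graph on H_n(D).) -/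
open Matrix in
theorem rowRank_add_finrank_ker_vecMulLinear {D : Type*} [DivisionRing D] {n : ℕ}
    (A : Matrix (Fin n) (Fin n) D) :
    rowRank A + Module.finrank D (LinearMap.ker A.vecMulLinear) = n := by
  have h := LinearMap.finrank_range_add_finrank_ker A.vecMulLinear
  rw [range_vecMulLinear, Module.finrank_fin_fun] at h
  exact h

open Matrix in
theorem exists_left_inverse_of_rowRank_eq {D : Type*} [DivisionRing D] {n : ℕ}
    {A : Matrix (Fin n) (Fin n) D} (h : rowRank A = n) :
    ∃ P : Matrix (Fin n) (Fin n) D, P * A = 1 := by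
  have htop : LinearMap.range A.vecMulLinear = ⊤ := by
    apply Submodule.eq_top_of_finrank_eq
    rw [range_vecMulLinear, Module.finrank_fin_fun]
    exact h
  have hsurj := LinearMap.range_eq_top.mp htop
  choose c hc using fun i : Fin n => hsurj (Pi.single i 1)
  refine ⟨Matrix.of c, ?_⟩
  ext i j
  have := congrFun (hc i) j
  rw [Matrix.one_apply, Matrix.mul_apply]
  simpa [Matrix.vecMul, dotProduct, Pi.single_apply, eq_comm] using this

open Matrix in
/-- A Hermitian matrix of full rank has a two-sided Hermitian inverse. -/
theorem exists_isHermitian_inverse_of_rowRank_eq {D : Type*} [DivisionRing D] [StarRing D] {n : ℕ}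
    {A : Matrix (Fin n) (Fin n) D} (hA : A.IsHermitian) (h : rowRank A = n) :
    ∃ P : Matrix (Fin n) (Fin n) D, P.IsHermitian ∧ P * A = 1 ∧ A * P = 1 := by
  obtain ⟨P, hP⟩ := exists_left_inverse_of_rowRank_eq h
  have hP' : A * Pᴴ = 1 := by
    rw [← hA.eq, ← conjTranspose_mul, hP, conjTranspose_one]
  have hPH : P = Pᴴ := left_inv_eq_right_inv hP hP'
  exact ⟨P, hPH.symm, hP, by rwa [← hPH] at hP'⟩

open Matrix in
/-- A nonzero Hermitian form has an anisotropic vector unless the involution is negation. -/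
theorem exists_dotProduct_mulVec_ne_zero {D : Type*} [DivisionRing D] [StarRing D] {n : ℕ}
    {M : Matrix (Fin n) (Fin n) D} (hM : M.IsHermitian) (hM0 : M ≠ 0)
    (hD : ¬ ∀ x : D, star x = -x) : ∃ u : Fin n → D, star u ⬝ᵥ M *ᵥ u ≠ 0 := by
  by_contra! hall
  obtain ⟨i, j, hij⟩ : ∃ i j, M i j ≠ 0 := by
    by_contra! h
    exact hM0 (Matrix.ext h)
  refine hD fun y => ?_
  have h := hall (Pi.single i 1 + Pi.single j ((M i j)⁻¹ * y))
  have hi := hall (Pi.single i 1)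
  have hj := hall (Pi.single j ((M i j)⁻¹ * y))
  rw [star_add, mulVec_add, add_dotProduct, dotProduct_add, dotProduct_add, hi, hj, zero_add,
    add_zero] at h
  have h1 : star (Pi.single i (1 : D)) ⬝ᵥ M *ᵥ Pi.single j ((M i j)⁻¹ * y) = y := by
    rw [← Pi.single_star]
    simp [mulVec_single, mul_inv_cancel_left₀ hij]
  have h2 : star (Pi.single j ((M i j)⁻¹ * y)) ⬝ᵥ M *ᵥ Pi.single i (1 : D) = star y := by
    rw [← Pi.single_star]
    simp only [mulVec_single, single_dotProduct, MulOpposite.op_one, one_smul, col_apply]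
    rw [← hM.apply j i, ← star_mul, mul_inv_cancel_left₀ hij]
  rw [h1, h2] at h
  exact eq_neg_of_add_eq_zero_right h

open Matrix in
theorem dotProduct_mulVec_add_smul {D : Type*} [DivisionRing D] [StarRing D] {n : ℕ}
    (M : Matrix (Fin n) (Fin n) D) (u v : Fin n → D) {t : D}
    (ht : star t = t) (hc : ∀ x, x * t = t * x) :
    star (u + t • v) ⬝ᵥ M *ᵥ (u + t • v) = star u ⬝ᵥ M *ᵥ u
      + t * (star u ⬝ᵥ M *ᵥ v + star v ⬝ᵥ M *ᵥ u) + t * (t * (star v ⬝ᵥ M *ᵥ v)) := by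
  have h1 : ∀ x : Fin n → D, x ⬝ᵥ (t • M *ᵥ v) = t * (x ⬝ᵥ M *ᵥ v) := fun x => by
    simp only [dotProduct, Finset.mul_sum, Pi.smul_apply, smul_eq_mul, ← mul_assoc, hc]
  have h2 : M *ᵥ (t • v) = t • M *ᵥ v := by
    ext i
    simp only [mulVec, dotProduct, Finset.mul_sum, Pi.smul_apply, smul_eq_mul, ← mul_assoc, hc]
  have h3 : star (t • v) = t • star v := by
    ext i
    simp [ht, hc]
  rw [mulVec_add, star_add, h2, h3, add_dotProduct, dotProduct_add, dotProduct_add, h1,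
    smul_dotProduct, smul_dotProduct, h1, smul_eq_mul, smul_eq_mul, mul_add]
  abel

open Matrix in
/-- Two nonzero Hermitian forms have a common anisotropic vector. -/
theorem exists_dotProduct_mulVec_ne_zero_and {D : Type*} [DivisionRing D] [StarRing D] {n : ℕ}
    {P Q : Matrix (Fin n) (Fin n) D} (hP : P.IsHermitian) (hP0 : P ≠ 0)
    (hQ : Q.IsHermitian) (hQ0 : Q ≠ 0) (hD : ¬ ∀ x : D, star x = -x)
    {s : Finset D} (hs : 3 < s.card) (hs' : ∀ t ∈ s, star t = t ∧ ∀ x, x * t = t * x) :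
    ∃ u : Fin n → D, star u ⬝ᵥ P *ᵥ u ≠ 0 ∧ star u ⬝ᵥ Q *ᵥ u ≠ 0 := by
  classical
  obtain ⟨u, hu⟩ := exists_dotProduct_mulVec_ne_zero hP hP0 hD
  obtain ⟨v, hv⟩ := exists_dotProduct_mulVec_ne_zero hQ hQ0 hD
  by_cases hu' : star u ⬝ᵥ Q *ᵥ u = 0
  swap
  · exact ⟨u, hu, hu'⟩
  by_cases hv' : star v ⬝ᵥ P *ᵥ v = 0
  swap
  · exact ⟨v, hv', hv⟩
  set p := star u ⬝ᵥ P *ᵥ v + star v ⬝ᵥ P *ᵥ u with hp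
  set q := star u ⬝ᵥ Q *ᵥ v + star v ⬝ᵥ Q *ᵥ u with hq
  obtain ⟨t, hts, ht⟩ : ∃ t ∈ s, t ∉ ({0, -(star u ⬝ᵥ P *ᵥ u) * p⁻¹,
      -q * (star v ⬝ᵥ Q *ᵥ v)⁻¹} : Finset D) :=
    Finset.exists_mem_notMem_of_card_lt_card (Finset.card_le_three.trans_lt hs)
  simp only [Finset.mem_insert, Finset.mem_singleton, not_or] at ht
  obtain ⟨ht0, htp, htq⟩ := ht
  obtain ⟨hst, hct⟩ := hs' t hts
  refine ⟨u + t • v, ?_, ?_⟩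
  · rw [dotProduct_mulVec_add_smul P u v hst hct, ← hp, hv', mul_zero, mul_zero, add_zero]
    intro h
    have hp0 : p ≠ 0 := by
      rintro h0
      rw [h0, mul_zero, add_zero] at h
      exact hu h
    exact htp (by rw [eq_mul_inv_iff_mul_eq₀ hp0]; exact eq_neg_of_add_eq_zero_right h)
  · rw [dotProduct_mulVec_add_smul Q u v hst hct, ← hq, hu', zero_add, ← mul_add]
    refine mul_ne_zero ht0 fun h => htq ?_
    rw [eq_mul_inv_iff_mul_eq₀ hv]
    exact eq_neg_of_add_eq_zero_right h

open Matrix in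
theorem rowRank_vecMulVec {D : Type*} [DivisionRing D] {n : ℕ} {w v : Fin n → D}
    (hw : w ≠ 0) (hv : v ≠ 0) : rowRank (vecMulVec w v) = 1 := by
  obtain ⟨i, hi⟩ := Function.ne_iff.mp hw
  have : Submodule.span D (Set.range fun i => vecMulVec w v i) = Submodule.span D {v} := by
    apply le_antisymm
    · rw [Submodule.span_le]
      rintro _ ⟨k, rfl⟩
      exact Submodule.mem_span_singleton.mpr ⟨w k, rfl⟩
    · rw [Submodule.span_singleton_le_iff_mem]
      have h := Submodule.smul_mem _ (w i)⁻¹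
        (Submodule.subset_span (R := D) (Set.mem_range_self (f := fun i => vecMulVec w v i) i))
      convert h using 1
      ext k
      simp [vecMulVec_apply, inv_mul_cancel_left₀ hi]
  rw [rowRank, this, finrank_span_singleton hv]

open Matrix in
theorem eq_smul_of_vecMul_sub_vecMulVec_eq_zero {D : Type*} [DivisionRing D] {n : ℕ}
    {A P : Matrix (Fin n) (Fin n) D} (hAP : A * P = 1) {w v x : Fin n → D}
    (h : x ᵥ* (A - vecMulVec w v) = 0) : x = (x ⬝ᵥ w) • v ᵥ* P := by
  rw [vecMul_sub, sub_eq_zero, vecMul_vecMulVec] at h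
  rw [← smul_vecMul, ← h, vecMul_vecMul, hAP, vecMul_one]

open Matrix in
/-- A rank one perturbation with `v ᵥ* A⁻¹ ⬝ᵥ w ≠ 1` of an invertible matrix has full rank. -/
theorem rowRank_sub_vecMulVec_of_ne {D : Type*} [DivisionRing D] {n : ℕ}
    {A P : Matrix (Fin n) (Fin n) D} (hAP : A * P = 1) {w v : Fin n → D}
    (h : v ᵥ* P ⬝ᵥ w ≠ 1) : rowRank (A - vecMulVec w v) = n := by
  have hker : LinearMap.ker (A - vecMulVec w v).vecMulLinear = ⊥ := by
    refine (Submodule.eq_bot_iff _).mpr fun x hx => ?_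
    have hx' := eq_smul_of_vecMul_sub_vecMulVec_eq_zero hAP hx
    have hc : x ⬝ᵥ w = (x ⬝ᵥ w) * (v ᵥ* P ⬝ᵥ w) := by
      conv_lhs => rw [hx', smul_dotProduct, smul_eq_mul]
    by_cases h0 : x ⬝ᵥ w = 0
    · rw [hx', h0, zero_smul]
    · exact absurd (mul_left_cancel₀ h0 (by rw [← hc, mul_one])) h
  have := rowRank_add_finrank_ker_vecMulLinear (A - vecMulVec w v)
  rwa [hker, finrank_bot, add_zero] at this

open Matrix in
/-- A rank one perturbation with `v ᵥ* A⁻¹ ⬝ᵥ w = 1` of an invertible matrix has corank one. -/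
theorem rowRank_sub_vecMulVec_of_eq {D : Type*} [DivisionRing D] {n : ℕ}
    {A P : Matrix (Fin n) (Fin n) D} (hAP : A * P = 1) (hPA : P * A = 1) {w v : Fin n → D}
    (h : v ᵥ* P ⬝ᵥ w = 1) : rowRank (A - vecMulVec w v) = n - 1 := by
  have hker : LinearMap.ker (A - vecMulVec w v).vecMulLinear = Submodule.span D {v ᵥ* P} := by
    apply le_antisymm
    · intro x hx
      exact Submodule.mem_span_singleton.mpr
        ⟨_, (eq_smul_of_vecMul_sub_vecMulVec_eq_zero hAP hx).symm⟩
    · rw [Submodule.span_singleton_le_iff_mem, LinearMap.mem_ker, vecMulLinear_apply, vecMul_sub,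
        vecMul_vecMulVec, h, vecMul_vecMul, hPA, vecMul_one, one_smul, sub_self]
  have hne : v ᵥ* P ≠ 0 := by
    intro h0
    rw [h0, zero_dotProduct] at h
    exact zero_ne_one h
  have := rowRank_add_finrank_ker_vecMulLinear (A - vecMulVec w v)
  rw [hker, finrank_span_singleton hne] at this
  omega

open Matrix in
/-- Given two distinct invertible Hermitian matrices, some Hermitian matrix of rank one can be
subtracted so that the first becomes singular of corank one and the second stays invertible. -/
theorem exists_isHermitian_rowRank_eq_one {D : Type*} [DivisionRing D] [StarRing D] {n : ℕ}
    (hD : ¬ ∀ x : D, star x = -x) {s : Finset D} (hs : 3 < s.card)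
    (hs' : ∀ t ∈ s, star t = t ∧ ∀ x, x * t = t * x) (hn : n ≠ 0)
    {A B : Matrix (Fin n) (Fin n) D} (hA : A.IsHermitian) (hB : B.IsHermitian) (hAB : A ≠ B)
    (hAr : rowRank A = n) (hBr : rowRank B = n) :
    ∃ R : Matrix (Fin n) (Fin n) D, R.IsHermitian ∧ rowRank (-R) = 1 ∧
      rowRank (A - R) = n - 1 ∧ rowRank (B - R) = n := by
  obtain ⟨P, hPH, hPA, hAP⟩ := exists_isHermitian_inverse_of_rowRank_eq hA hAr
  obtain ⟨Q, hQH, hQB, hBQ⟩ := exists_isHermitian_inverse_of_rowRank_eq hB hBr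
  have : NeZero n := ⟨hn⟩
  have hP0 : P ≠ 0 := by
    rintro rfl
    rw [zero_mul] at hPA
    exact zero_ne_one hPA
  have hPQ : P - Q ≠ 0 := by
    intro h
    rw [sub_eq_zero] at h
    subst h
    exact hAB (left_inv_eq_right_inv hAP hQB)
  obtain ⟨u, huP, huPQ⟩ :=
    exists_dotProduct_mulVec_ne_zero_and hPH hP0 (hPH.sub hQH) hPQ hD hs hs'
  set p := star u ⬝ᵥ P *ᵥ u with hp
  have hpstar : star p = p := by
    rw [hp, ← star_dotProduct_star, star_mulVec, star_star, hPH.eq, dotProduct_mulVec]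
  have hu0 : u ≠ 0 := by
    rintro rfl
    simp [hp] at huP
  set w : Fin n → D := MulOpposite.op p⁻¹ • u with hw
  have hdot : ∀ y : Fin n → D, y ⬝ᵥ w = (y ⬝ᵥ u) * p⁻¹ := fun y => by
    simp [hw, dotProduct_smul]
  have hw0 : w ≠ 0 := smul_ne_zero (by simpa using huP) hu0
  have hu0' : star u ≠ 0 := star_ne_zero.mpr hu0
  refine ⟨vecMulVec w (star u), ?_, ?_, ?_, ?_⟩
  · ext i j
    simp [hw, vecMulVec_apply, hpstar, mul_assoc]
  · rw [← neg_vecMulVec]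
    exact rowRank_vecMulVec (neg_ne_zero.mpr hw0) hu0'
  · apply rowRank_sub_vecMulVec_of_eq hAP hPA
    rw [hdot, ← dotProduct_mulVec, ← hp, mul_inv_cancel₀ huP]
  · apply rowRank_sub_vecMulVec_of_ne hBQ
    rw [hdot, ← dotProduct_mulVec]
    intro h
    rw [mul_inv_eq_one₀ huP] at h
    rw [sub_mulVec, dotProduct_sub, h, ← hp, sub_self] at huPQ
    exact huPQ rfl

/-- condition (A4) for the graph on the space of Hermitian
`n × n` matrices over a division ring with involution `σ` subject to (R1) and
(R2) (graph distance = rank of the difference, diameter = n). -/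
theorem stmt_10 {D : Type*} [DivisionRing D] (σ : D → D)
    (hadd : ∀ x y : D, σ (x + y) = σ x + σ y)
    (hmul : ∀ x y : D, σ (x * y) = σ y * σ x)
    (hinv : ∀ x : D, σ (σ x) = x)
    (hR1 : ∃ s : Finset D, 3 < s.card ∧ ∀ x ∈ s, σ x = x ∧ x ∈ Subring.center D)
    (hR2 : σ = id → (2 : D) ≠ 0)
    {n : ℕ} (hn : 2 ≤ n)
    (X Y Z : Matrix (Fin n) (Fin n) D)
    (hX : ∀ i j, σ (X j i) = X i j) (hY : ∀ i j, σ (Y j i) = Y i j)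
    (hZ : ∀ i j, σ (Z j i) = Z i j)
    (hXY : X ≠ Y)
    (hXZ : rowRank (X - Z) = n) (hYZ : rowRank (Y - Z) = n) :
    ∃ W : Matrix (Fin n) (Fin n) D, (∀ i j, σ (W j i) = W i j) ∧
      rowRank (Z - W) = 1 ∧ rowRank (X - W) = n - 1 ∧ rowRank (Y - W) = n := by
  let _ : StarRing D :=
    { star := σ, star_involutive := hinv, star_mul := hmul, star_add := hadd }
  have hD : ¬ ∀ x : D, star x = -x := by
    intro h
    have h1 : (1 : D) = -1 := by rw [← h 1, star_one]
    refine hR2 (funext fun x => (h x).trans ?_) ?_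
    · rw [← neg_one_mul, ← h1, one_mul, id]
    · rw [← one_add_one_eq_two]
      exact add_eq_zero_iff_eq_neg.mpr h1
  obtain ⟨s, hs, hs'⟩ := hR1
  have hXH : X.IsHermitian := Matrix.ext hX
  have hYH : Y.IsHermitian := Matrix.ext hY
  have hZH : Z.IsHermitian := Matrix.ext hZ
  obtain ⟨R, hR, hR1, hRX, hRY⟩ := exists_isHermitian_rowRank_eq_one hD hs
    (fun t ht => ⟨(hs' t ht).1, Subring.mem_center_iff.mp (hs' t ht).2⟩) (by omega)
    (hXH.sub hZH) (hYH.sub hZH) (fun h => hXY (sub_left_injective h)) hXZ hYZ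
  refine ⟨Z + R, fun i j => (hZH.add hR).apply i j, ?_, ?_, ?_⟩
  · rwa [sub_add_cancel_left]
  · rwa [← sub_sub]
  · rwa [← sub_sub]
end

section
/- Let D be a division ring and m, n integers with 2 ≤ m ≤ n. Let X, Y, Z be m-dimensional subspaces of the (m+n)-dimensional left vector space V over D with X ≠ Y, X ∩ Z = {0} and Y ∩ Z = {0}. Then there exists an m-dimensional subspace W of V with dim(Z ∩ W) = m − 1, dim(X ∩ W) = 1, and Y ∩ W = {0}. (This is condition (A4) for the graph on the Grassmann space G(m, m+n; D) when m ≤ n.) -/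
/-- A finite-dimensional subspace has a hyperplane avoiding any given nonzero vector of it. -/
lemma Submodule.exists_le_finrank_add_one_notMem {K V : Type*} [DivisionRing K] [AddCommGroup V]
    [Module K V] [FiniteDimensional K V] (Z : Submodule K V) {z : V} (hz : z ∈ Z) (hz0 : z ≠ 0) :
    ∃ U ≤ Z, Module.finrank K U + 1 = Module.finrank K Z ∧ z ∉ U := by
  obtain ⟨C, hC⟩ := Submodule.exists_isCompl (K ∙ z)
  have hzZ : K ∙ z ≤ Z := (Submodule.span_singleton_le_iff_mem z Z).2 hz
  have hsup : (K ∙ z) ⊔ C ⊓ Z = Z := by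
    rw [← sup_inf_assoc_of_le C hzZ, hC.sup_eq_top, top_inf_eq]
  have hinf : (K ∙ z) ⊓ (C ⊓ Z) = ⊥ := by
    rw [← inf_assoc, hC.inf_eq_bot, bot_inf_eq]
  refine ⟨C ⊓ Z, inf_le_right, ?_, fun h => hz0 ?_⟩
  · have h := Submodule.finrank_sup_add_finrank_inf_eq (K ∙ z) (C ⊓ Z)
    rw [hsup, hinf, finrank_bot, finrank_span_singleton hz0] at h
    omega
  · have h' : z ∈ (K ∙ z) ⊓ (C ⊓ Z) := ⟨Submodule.mem_span_singleton_self z, h⟩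
    rwa [hinf, Submodule.mem_bot] at h'

/-- condition (A4) for the graph on the Grassmann space
`G(m, m+n; D)` in the case `m ≤ n`. Points are the `m`-dimensional subspaces of
the `(m+n)`-dimensional left vector space `V = D^(m+n)`; two points are adjacent
if their intersection has dimension `m - 1`, the distance is
`m - dim(intersection)` and the diameter is `min{m,n} = m`. -/
theorem stmt_12 {D : Type*} [DivisionRing D] {m n : ℕ} (hm : 2 ≤ m) (hmn : m ≤ n)
    (X Y Z : Submodule D (Fin (m + n) → D))
    (hX : Module.finrank D X = m) (hY : Module.finrank D Y = m)
    (hZ : Module.finrank D Z = m)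
    (hXY : X ≠ Y) (hXZ : X ⊓ Z = ⊥) (hYZ : Y ⊓ Z = ⊥) :
    ∃ W : Submodule D (Fin (m + n) → D), Module.finrank D W = m ∧
      Module.finrank D ↥(Z ⊓ W) = m - 1 ∧
      Module.finrank D ↥(X ⊓ W) = 1 ∧
      Y ⊓ W = ⊥ := by
  obtain ⟨x, hxX, hxY⟩ : ∃ x ∈ X, x ∉ Y := by
    by_contra! h
    exact hXY (Submodule.eq_of_le_of_finrank_eq h (hX.trans hY.symm))
  obtain ⟨z, hzZ, hz0, hxz⟩ : ∃ z ∈ Z, z ≠ 0 ∧ (x ∈ Y ⊔ Z → x - z ∈ Y) := by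
    by_cases hx : x ∈ Y ⊔ Z
    · obtain ⟨y, hy, z, hz, rfl⟩ := Submodule.mem_sup.1 hx
      refine ⟨z, hz, ?_, fun _ => by simpa using hy⟩
      rintro rfl
      exact hxY (by simpa using hy)
    · have hZ0 : Z ≠ ⊥ := by
        rintro rfl
        rw [finrank_bot] at hZ
        omega
      obtain ⟨z, hz, hz0⟩ := Submodule.exists_mem_ne_zero_of_ne_bot hZ0
      exact ⟨z, hz, hz0, fun h => absurd h hx⟩
  obtain ⟨U, hUZ, hU, hzU⟩ := Submodule.exists_le_finrank_add_one_notMem Z hzZ hz0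
  have hx0 : x ≠ 0 := fun h => hxY (h ▸ Y.zero_mem)
  have hspan : D ∙ x ≤ X := (Submodule.span_singleton_le_iff_mem x X).2 hxX
  have hxYU : x ∉ Y ⊔ U := by
    intro h
    have hy := hxz (sup_le_sup_left hUZ Y h)
    obtain ⟨y, hyY, u, hu, rfl⟩ := Submodule.mem_sup.1 h
    have hmem : u - z ∈ Y ⊓ Z := by
      refine ⟨?_, Z.sub_mem (hUZ hu) hzZ⟩
      have := Y.sub_mem hy hyY
      rwa [show y + u - z - y = u - z by abel] at this
    rw [hYZ, Submodule.mem_bot, sub_eq_zero] at hmem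
    exact hzU (hmem ▸ hu)
  have hXU : U ⊓ X = ⊥ := le_bot_iff.1 (hXZ ▸ inf_comm X Z ▸ inf_le_inf_right X hUZ)
  have hUx : U ⊓ (D ∙ x) = ⊥ := le_bot_iff.1 (hXU ▸ inf_le_inf_left U hspan)
  have hZW : Z ⊓ (U ⊔ D ∙ x) = U := by
    have hxZ : (D ∙ x) ⊓ Z = ⊥ := le_bot_iff.1 (hXZ ▸ inf_le_inf_right Z hspan)
    rw [inf_comm, sup_inf_assoc_of_le _ hUZ, hxZ, sup_bot_eq]
  have hXW : X ⊓ (U ⊔ D ∙ x) = D ∙ x := by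
    rw [inf_comm, sup_comm, sup_inf_assoc_of_le _ hspan, hXU, sup_bot_eq]
  refine ⟨U ⊔ D ∙ x, ?_, ?_, ?_, ?_⟩
  · have h := Submodule.finrank_sup_add_finrank_inf_eq U (D ∙ x)
    rw [hUx, finrank_bot, finrank_span_singleton hx0] at h
    omega
  · rw [hZW]
    omega
  · rw [hXW, finrank_span_singleton hx0]
  · refine (Submodule.eq_bot_iff _).2 ?_
    rintro w ⟨hwY, hwW⟩
    obtain ⟨u, hu, v, hv, rfl⟩ := Submodule.mem_sup.1 hwW
    obtain ⟨a, rfl⟩ := Submodule.mem_span_singleton.1 hv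
    have ha : a = 0 := by
      by_contra ha
      refine hxYU (((Y ⊔ U).smul_mem_iff ha).1 ?_)
      have := (Y ⊔ U).sub_mem (Submodule.mem_sup_left hwY) (Submodule.mem_sup_right hu)
      rwa [add_sub_cancel_left] at this
    subst ha
    rw [zero_smul, add_zero] at hwY ⊢
    have hmem : u ∈ Y ⊓ Z := ⟨hwY, hUZ hu⟩
    rwa [hYZ, Submodule.mem_bot] at hmem
end

section
/- Let D, D' be division rings and m, n, p, q integers ≥ 2. If φ : G(m, m+n; D) → G(p, p+q; D') is a surjection satisfying, for all A, B ∈ G(m, m+n; D), d(A,B) = min{m,n} if and only if d(A^φ, B^φ) = min{p,q} (equivalently, dim(A ∩ B) = m − min{m,n} if and only if dim(A^φ ∩ B^φ) = p − min{p,q}), then φ is bijective, both φ and φ⁻¹ preserve adjacency of subspaces (i.e. dim(A ∩ B) = m − 1 if and only if dim(A^φ ∩ B^φ) = p − 1), and min{m,n} = min{p,q}. -/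
/-- A rank function on a bounded lattice, with the properties that the dimension has on the
lattice of subspaces of a finite-dimensional vector space. -/
structure IsProjectiveRank {L : Type*} [Lattice L] [BoundedOrder L] (r : L → ℕ) : Prop where
  bot : r ⊥ = 0
  strictMono : StrictMono r
  sup_add_inf : ∀ a b, r (a ⊔ b) + r (a ⊓ b) = r a + r b
  exists_between : ∀ a b k, a ≤ b → r a ≤ k → k ≤ r b → ∃ c, a ≤ c ∧ c ≤ b ∧ r c = k
  exists_third : ∀ a b, r a = r b → r (a ⊔ b) = r a + 1 →
    ∃ c, c ≠ a ∧ c ≠ b ∧ a ⊓ b ≤ c ∧ c ≤ a ⊔ b ∧ r c = r a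

namespace IsProjectiveRank

section Lattice

variable {L : Type*} [Lattice L] [BoundedOrder L] {r : L → ℕ}

theorem dual (h : IsProjectiveRank r) :
    IsProjectiveRank (L := Lᵒᵈ) (fun x => r ⊤ - r (OrderDual.ofDual x)) := by
  have top : ∀ a : L, r a ≤ r ⊤ := fun a => h.strictMono.monotone le_top
  refine ⟨?_, ?_, ?_, ?_, ?_⟩
  · simp
  · intro a b hab
    have := h.strictMono (OrderDual.ofDual_lt_ofDual.2 hab)
    have := top (OrderDual.ofDual a)
    have := top (OrderDual.ofDual b)
    dsimp only
    omega
  · intro a b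
    have := h.sup_add_inf (OrderDual.ofDual a) (OrderDual.ofDual b)
    have := top (OrderDual.ofDual a)
    have := top (OrderDual.ofDual b)
    have := top (OrderDual.ofDual a ⊔ OrderDual.ofDual b)
    have := top (OrderDual.ofDual a ⊓ OrderDual.ofDual b)
    rw [ofDual_sup, ofDual_inf]
    omega
  · intro a b k hab hak hkb
    have := top (OrderDual.ofDual a)
    have := top (OrderDual.ofDual b)
    obtain ⟨c, hbc, hca, hc⟩ := h.exists_between (OrderDual.ofDual b) (OrderDual.ofDual a)
      (r ⊤ - k) (OrderDual.ofDual_le_ofDual.2 hab) (by omega) (by omega)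
    exact ⟨OrderDual.toDual c, hca, hbc, by simp only [OrderDual.ofDual_toDual]; omega⟩
  · intro a b hab hs
    have h1 := h.sup_add_inf (OrderDual.ofDual a) (OrderDual.ofDual b)
    have h2 := top (OrderDual.ofDual a)
    have h3 := top (OrderDual.ofDual b)
    have h4 := top (OrderDual.ofDual a ⊓ OrderDual.ofDual b)
    rw [ofDual_sup] at hs
    obtain ⟨c, hca, hcb, h5, h6, h7⟩ := h.exists_third (OrderDual.ofDual a) (OrderDual.ofDual b)
      (by omega) (by omega)
    exact ⟨OrderDual.toDual c, hca, hcb, h6, h5, by simp only [OrderDual.ofDual_toDual]; omega⟩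

theorem eq_bot (h : IsProjectiveRank r) {a : L} (ha : r a = 0) : a = ⊥ := by
  by_contra hne
  have := h.strictMono (bot_lt_iff_ne_bot.2 hne)
  omega

theorem eq_of_le (h : IsProjectiveRank r) {a b : L} (hab : a ≤ b) (hr : r b ≤ r a) : a = b := by
  by_contra hne
  have := h.strictMono (lt_of_le_of_ne hab hne)
  omega

theorem lt_sup (h : IsProjectiveRank r) {a b : L} (hr : r a = r b) (hne : a ≠ b) :
    r a < r (a ⊔ b) := by
  refine h.strictMono (lt_of_le_of_ne le_sup_left fun he => hne ?_)
  exact (h.eq_of_le (sup_eq_left.1 he.symm) hr.le).symm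

theorem disjoint_iff (h : IsProjectiveRank r) {a b : L} : Disjoint a b ↔ r (a ⊓ b) = 0 :=
  ⟨fun hd => by rw [hd.eq_bot, h.bot], fun h0 => _root_.disjoint_iff.2 (h.eq_bot h0)⟩

theorem sup_of_disjoint (h : IsProjectiveRank r) {a b : L} (hd : Disjoint a b) :
    r (a ⊔ b) = r a + r b := by
  have := h.sup_add_inf a b
  rwa [h.disjoint_iff.1 hd, add_zero] at this

theorem disjoint_of_adjacent (h : IsProjectiveRank r) {m : ℕ} {a b : L} (ha : r a = m)
    (hb : r b = m) (hab : r (a ⊔ b) = m + 1) :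
    ∃ c, r c = m ∧ c ≠ a ∧ c ≠ b ∧ ∀ x, Disjoint x c → Disjoint x a ∨ Disjoint x b := by
  obtain ⟨c, hca, hcb, h1, h2, hc⟩ := h.exists_third a b (by omega) (by omega)
  refine ⟨c, by omega, hca, hcb, fun x hx => ?_⟩
  by_contra! hn
  have h3 := h.sup_of_disjoint (hx.mono_left (inf_le_left : x ⊓ (a ⊔ b) ≤ x))
  have h4 := h.strictMono.monotone (sup_le (inf_le_right : x ⊓ (a ⊔ b) ≤ a ⊔ b) h2)
  have h5 := mt h.disjoint_iff.2 hn.1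
  have h6 := mt h.disjoint_iff.2 hn.2
  have h7 := h.eq_of_le (inf_le_inf_left x (le_sup_left : a ≤ a ⊔ b)) (by omega)
  have h8 := h.eq_of_le (inf_le_inf_left x (le_sup_right : b ≤ a ⊔ b)) (by omega)
  refine hn.1 (_root_.disjoint_iff_inf_le.2 ?_)
  exact hx inf_le_left
    ((le_inf inf_le_right ((h7.trans h8.symm).le.trans inf_le_right)).trans h1)

variable [IsModularLattice L] [ComplementedLattice L]

/-- If `a ≰ c` then some point of `a` lies outside `c`. -/
theorem exists_point (h : IsProjectiveRank r) {a c : L} (hac : ¬ a ≤ c) :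
    ∃ P, P ≤ a ∧ r P = 1 ∧ Disjoint P c := by
  obtain ⟨w, hw⟩ := exists_isCompl (a ⊓ c)
  have h1 : (a ⊓ c) ⊔ (w ⊓ a) = a := by
    rw [← sup_inf_assoc_of_le w (inf_le_left : a ⊓ c ≤ a), hw.sup_eq_top, top_inf_eq]
  have h2 : r (w ⊓ a) ≠ 0 := by
    intro h0
    rw [h.eq_bot h0, sup_bot_eq] at h1
    exact hac (inf_eq_left.1 h1)
  obtain ⟨P, -, hP, hr⟩ := h.exists_between ⊥ (w ⊓ a) 1 bot_le (by rw [h.bot]; omega) (by omega)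
  refine ⟨P, hP.trans inf_le_right, hr, ?_⟩
  rw [_root_.disjoint_iff_inf_le, ← hw.inf_eq_bot]
  exact le_inf (le_inf (inf_le_left.trans (hP.trans inf_le_right)) inf_le_right)
    (inf_le_left.trans (hP.trans inf_le_left))

/-- An element disjoint from `c` extends to an element of any admissible rank disjoint from `c`. -/
theorem exists_extension (h : IsProjectiveRank r) {y c : L} {m : ℕ} (hd : Disjoint y c)
    (hy : r y ≤ m) (hm : m + r c ≤ r ⊤) : ∃ x, y ≤ x ∧ r x = m ∧ Disjoint x c := by
  obtain ⟨w, hw⟩ := exists_isCompl (y ⊔ c)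
  have h1 := h.sup_of_disjoint hw.disjoint
  rw [hw.sup_eq_top, h.sup_of_disjoint hd] at h1
  have h2 : Disjoint (y ⊔ w) c := by
    have := (hd.symm.disjoint_sup_right_of_disjoint_sup_left (by rw [sup_comm]; exact hw.disjoint))
    exact this.symm
  have h3 : r (y ⊔ w) = r y + r w := h.sup_of_disjoint (hw.disjoint.mono_left le_sup_left)
  obtain ⟨x, hyx, hxw, hx⟩ := h.exists_between y (y ⊔ w) m le_sup_left hy (by omega)
  exact ⟨x, hyx, hx, h2.mono_left hxw⟩

theorem exists_disjoint_pair (h : IsProjectiveRank r) {m : ℕ} (hm : m + m ≤ r ⊤) :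
    ∃ a b, r a = m ∧ r b = m ∧ Disjoint a b := by
  obtain ⟨b, -, -, hb⟩ := h.exists_between ⊥ ⊤ m bot_le (by rw [h.bot]; omega) (by omega)
  obtain ⟨a, -, ha, hab⟩ := h.exists_extension (disjoint_bot_left (a := b)) (m := m)
    (by rw [h.bot]; omega) (by omega)
  exact ⟨a, b, ha, hb, hab⟩

theorem eq_of_disjoint_iff (h : IsProjectiveRank r) {m : ℕ} (hm1 : 1 ≤ m) (hm : m + m ≤ r ⊤)
    {a b : L} (ha : r a = m) (hb : r b = m)
    (hab : ∀ x, r x = m → (Disjoint x a ↔ Disjoint x b)) : a = b := by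
  by_contra hne
  obtain ⟨P, hPb, hP, hd⟩ := h.exists_point
    (fun hle => hne (h.eq_of_le hle (by omega)).symm : ¬ b ≤ a)
  obtain ⟨x, hPx, hx, hxa⟩ := h.exists_extension hd (m := m) (by omega) (by omega)
  have : P = ⊥ := le_bot_iff.1 ((hab x hx).1 hxa |>.symm hPb hPx)
  rw [this, h.bot] at hP
  omega

theorem adjacent_of_disjoint (h : IsProjectiveRank r) {m : ℕ} (hm2 : 2 ≤ m) (hm : m + m ≤ r ⊤)
    {a b c : L} (ha : r a = m) (hb : r b = m) (hc : r c = m) (hne : a ≠ b) (hca : c ≠ a)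
    (hcb : c ≠ b) (hx : ∀ x, r x = m → Disjoint x c → Disjoint x a ∨ Disjoint x b) :
    r (a ⊔ b) = m + 1 := by
  have small : ∀ P Q, P ≤ a → Q ≤ b → r P = 1 → r Q = 1 → ¬ Disjoint (P ⊔ Q) c := by
    intro P Q hPa hQb hP hQ hd
    have h1 := h.sup_add_inf P Q
    obtain ⟨x, hPx, hxm, hxc⟩ := h.exists_extension hd (m := m) (by omega) (by omega)
    rcases hx x hxm hxc with h2 | h2
    · have := le_bot_iff.1 (h2 (le_sup_left.trans hPx) hPa)
      rw [this, h.bot] at hP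
      omega
    · have := le_bot_iff.1 (h2 (le_sup_right.trans hPx) hQb)
      rw [this, h.bot] at hQ
      omega
  obtain ⟨P, hPa, hP, hPc⟩ := h.exists_point
    (fun hle => hca (h.eq_of_le hle (by omega)).symm : ¬ a ≤ c)
  obtain ⟨Q, hQb, hQ, hQc⟩ := h.exists_point
    (fun hle => hcb (h.eq_of_le hle (by omega)).symm : ¬ b ≤ c)
  have hb' : b ≤ P ⊔ c := by
    by_contra hn
    obtain ⟨Q', hQ'b, hQ', hd⟩ := h.exists_point hn
    refine small P Q' hPa hQ'b hP hQ' ?_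
    exact (hPc.symm.disjoint_sup_right_of_disjoint_sup_left (by rw [sup_comm]; exact hd.symm)).symm
  have ha' : a ≤ Q ⊔ c := by
    by_contra hn
    obtain ⟨P', hP'a, hP', hd⟩ := h.exists_point hn
    refine small P' Q hP'a hQb hP' hQ ?_
    rw [sup_comm]
    exact (hQc.symm.disjoint_sup_right_of_disjoint_sup_left (by rw [sup_comm]; exact hd.symm)).symm
  have h1 : a ⊔ b ≤ P ⊔ c :=
    sup_le (ha'.trans (sup_le (hQb.trans hb') le_sup_right)) hb'
  have h2 := h.strictMono.monotone h1
  have h3 := h.sup_of_disjoint hPc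
  have h4 := h.lt_sup (ha.trans hb.symm) hne
  omega

theorem adjacent_iff (h : IsProjectiveRank r) {m : ℕ} (hm2 : 2 ≤ m) (hm : m + m ≤ r ⊤)
    {a b : L} (ha : r a = m) (hb : r b = m) :
    r (a ⊔ b) = m + 1 ↔ a ≠ b ∧ ∃ c, r c = m ∧ c ≠ a ∧ c ≠ b ∧
      ∀ x, r x = m → Disjoint x c → Disjoint x a ∨ Disjoint x b := by
  constructor
  · intro hab
    refine ⟨?_, ?_⟩
    · rintro rfl
      rw [sup_idem] at hab
      omega
    · obtain ⟨c, hc, hca, hcb, hx⟩ := h.disjoint_of_adjacent ha hb hab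
      exact ⟨c, hc, hca, hcb, fun x _ => hx x⟩
  · rintro ⟨hne, c, hc, hca, hcb, hx⟩
    exact h.adjacent_of_disjoint hm2 hm ha hb hc hne hca hcb hx

/-- If `a ≠ b` have the same rank, then `a` has a neighbour that meets `b` in a larger rank. -/
theorem exists_closer (h : IsProjectiveRank r) {a b : L} (hr : r a = r b) (hne : a ≠ b) :
    ∃ c, r c = r a ∧ r (a ⊓ c) + 1 = r a ∧ r (a ⊓ b) + 1 ≤ r (c ⊓ b) := by
  have h0 := h.lt_sup hr hne
  have h1 := h.sup_add_inf a b
  obtain ⟨H, hH, hHa, hrH⟩ := h.exists_between (a ⊓ b) a (r a - 1) inf_le_left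
    (by omega) (by omega)
  obtain ⟨P, hPb, hP, hPa⟩ := h.exists_point
    (fun hle => hne (h.eq_of_le hle (by omega)).symm : ¬ b ≤ a)
  have h2 := h.sup_of_disjoint (hPa.mono_right hHa).symm
  have h3 := h.strictMono.monotone (le_inf hHa le_sup_left : H ≤ a ⊓ (H ⊔ P))
  have hne' : a ≠ H ⊔ P := by
    rintro he
    have := le_bot_iff.1 (hPa le_rfl (he ▸ le_sup_right))
    rw [this, h.bot] at hP
    omega
  have h4 := h.lt_sup (b := H ⊔ P) (by omega) hne'
  have h5 := h.sup_add_inf a (H ⊔ P)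
  have h6 := h.sup_of_disjoint (hPa.mono_right (inf_le_left : a ⊓ b ≤ a))
  have h7 := h.strictMono.monotone
    (le_inf (sup_le le_sup_right (hH.trans le_sup_left)) (sup_le hPb inf_le_right) :
      P ⊔ (a ⊓ b) ≤ (H ⊔ P) ⊓ b)
  exact ⟨H ⊔ P, by omega, by omega, by omega⟩

end Lattice

end IsProjectiveRank

section Grassmann

variable {K V : Type*} [DivisionRing K] [AddCommGroup V] [Module K V] [FiniteDimensional K V]

open Module

theorem Submodule.finrank_sup_span_singleton_of_notMem {s : Submodule K V} {v : V} (hv : v ∉ s) :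
    finrank K ↥(s ⊔ Submodule.span K {v}) = finrank K s + 1 := by
  have hv0 : v ≠ 0 := fun h => hv (h ▸ s.zero_mem)
  have h1 := Submodule.finrank_sup_add_finrank_inf_eq s (Submodule.span K {v})
  have h2 : Disjoint s (Submodule.span K {v}) := (Submodule.disjoint_span_singleton' hv0).2 hv
  rwa [h2.eq_bot, finrank_bot, finrank_span_singleton hv0, add_zero] at h1

theorem isProjectiveRank_finrank :
    IsProjectiveRank (fun W : Submodule K V => finrank K W) := by
  refine ⟨finrank_bot K V, fun _ _ h => Submodule.finrank_lt_finrank_of_lt h,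
    fun a b => Submodule.finrank_sup_add_finrank_inf_eq a b, ?_, ?_⟩
  · intro a b k hab hak
    induction k, hak using Nat.le_induction with
    | base => exact fun _ => ⟨a, le_rfl, hab, rfl⟩
    | succ k _ ih =>
      intro hk
      obtain ⟨c, hac, hcb, hc⟩ := ih (by omega)
      obtain ⟨v, hvb, hvc⟩ := SetLike.exists_of_lt (lt_of_le_of_ne hcb (by
        rintro rfl
        omega))
      refine ⟨c ⊔ Submodule.span K {v}, hac.trans le_sup_left,
        sup_le hcb ((Submodule.span_singleton_le_iff_mem _ _).2 hvb), ?_⟩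
      rw [Submodule.finrank_sup_span_singleton_of_notMem hvc, hc]
  · intro a b hab hs
    have h1 := Submodule.finrank_sup_add_finrank_inf_eq a b
    have hba : ¬ b ≤ a := fun hle => by rw [sup_eq_left.2 hle] at hs; omega
    have hab' : ¬ a ≤ b := fun hle => by rw [sup_eq_right.2 hle] at hs; omega
    obtain ⟨x, hxa, hxb⟩ := SetLike.not_le_iff_exists.1 hab'
    obtain ⟨y, hyb, hya⟩ := SetLike.not_le_iff_exists.1 hba
    have h2 : x + y ∉ a := fun h => hya ((Submodule.add_mem_iff_right a hxa).1 h)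
    have h3 : x + y ∉ b := fun h => hxb ((Submodule.add_mem_iff_left b hyb).1 h)
    have h4 : x + y ∈ (a ⊓ b) ⊔ Submodule.span K {x + y} :=
      Submodule.mem_sup_right (Submodule.mem_span_singleton_self _)
    refine ⟨(a ⊓ b) ⊔ Submodule.span K {x + y}, fun he => h2 (he ▸ h4), fun he => h3 (he ▸ h4),
      le_sup_left, sup_le inf_le_sup ?_, ?_⟩
    · exact (Submodule.span_singleton_le_iff_mem _ _).2 (Submodule.add_mem_sup hxa hyb)
    · rw [Submodule.finrank_sup_span_singleton_of_notMem fun h : x + y ∈ a ⊓ b => h2 h.1]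
      omega

/-- The points of the Grassmann space of `m`-dimensional subspaces of `V`. -/
abbrev GrassmannPoint (K V : Type*) [DivisionRing K] [AddCommGroup V] [Module K V] (m : ℕ) :=
  {W : Submodule K V // finrank K W = m}

theorem grassmann_opposite {m n : ℕ} (hm : 2 ≤ m) (hn : 2 ≤ n)
    (hV : finrank K V = m + n) :
    (∃ A B : GrassmannPoint K V m, finrank K ↥(A.val ⊓ B.val) = m - min m n) ∧
    (∀ A B : GrassmannPoint K V m,
      (∀ X : GrassmannPoint K V m, finrank K ↥(X.val ⊓ A.val) = m - min m n ↔
        finrank K ↥(X.val ⊓ B.val) = m - min m n) → A = B) ∧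
    (∀ A B : GrassmannPoint K V m, finrank K ↥(A.val ⊓ B.val) = m - 1 ↔
      A ≠ B ∧ ∃ C : GrassmannPoint K V m, C ≠ A ∧ C ≠ B ∧
        ∀ X : GrassmannPoint K V m, finrank K ↥(X.val ⊓ C.val) = m - min m n →
          finrank K ↥(X.val ⊓ A.val) = m - min m n ∨
          finrank K ↥(X.val ⊓ B.val) = m - min m n) := by
  have h := isProjectiveRank_finrank (K := K) (V := V)
  have htop : finrank K (⊤ : Submodule K V) = m + n := by rw [finrank_top, hV]
  have hsum := fun A B : GrassmannPoint K V m =>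
    Submodule.finrank_sup_add_finrank_inf_eq A.val B.val
  rcases le_total m n with hmn | hmn
  · have hopp : ∀ A B : GrassmannPoint K V m,
        finrank K ↥(A.val ⊓ B.val) = m - min m n ↔ Disjoint A.val B.val := by
      intro A B
      rw [h.disjoint_iff, min_eq_left hmn, Nat.sub_self]
    have hle : m + m ≤ finrank K (⊤ : Submodule K V) := by omega
    simp only [hopp]
    refine ⟨?_, ?_, ?_⟩
    · obtain ⟨a, b, ha, hb, hab⟩ := h.exists_disjoint_pair hle
      exact ⟨⟨a, ha⟩, ⟨b, hb⟩, hab⟩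
    · intro A B hAB
      exact Subtype.ext (h.eq_of_disjoint_iff (by omega) hle A.2 B.2 fun x hx => hAB ⟨x, hx⟩)
    · intro A B
      have h1 := h.adjacent_iff hm hle A.2 B.2
      have h2 := hsum A B
      have h3 := A.2
      have h4 := B.2
      simp only [Subtype.exists, Subtype.forall, ne_eq, Subtype.ext_iff, exists_prop] at h1 ⊢
      rw [← h1]
      omega
  · have h' := h.dual
    have hrank : ∀ W : Submodule K V, finrank K W ≤ m + n := fun W => hV ▸ W.finrank_le
    have hopp : ∀ A B : GrassmannPoint K V m,
        finrank K ↥(A.val ⊓ B.val) = m - min m n ↔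
          Disjoint (OrderDual.toDual A.val) (OrderDual.toDual B.val) := by
      intro A B
      have h2 := hsum A B
      have h3 := A.2
      have h4 := B.2
      have h5 := hrank (A.val ⊔ B.val)
      rw [h'.disjoint_iff, min_eq_right hmn, htop]
      change _ ↔ m + n - finrank K ↥(A.val ⊔ B.val) = 0
      omega
    have hn' : ∀ {W : Submodule K V}, finrank K W = m →
        finrank K (⊤ : Submodule K V) - finrank K W = n := by
      intro W hW
      omega
    have hm' : ∀ {W : Submodule K V}, finrank K (⊤ : Submodule K V) - finrank K W = n →
        finrank K W = m := by
      intro W hW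
      have := hrank W
      omega
    have hle : n + n ≤ finrank K (⊤ : Submodule K V) -
        finrank K (⊥ : Submodule K V) := by
      rw [finrank_bot]
      omega
    simp only [hopp]
    refine ⟨?_, ?_, ?_⟩
    · obtain ⟨a, b, ha, hb, hab⟩ := h'.exists_disjoint_pair hle
      exact ⟨⟨OrderDual.ofDual a, hm' ha⟩, ⟨OrderDual.ofDual b, hm' hb⟩, hab⟩
    · intro A B hAB
      exact Subtype.ext (h'.eq_of_disjoint_iff (by omega) hle
        (a := OrderDual.toDual A.val) (b := OrderDual.toDual B.val) (hn' A.2) (hn' B.2)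
        fun x hx => hAB ⟨OrderDual.ofDual x, hm' hx⟩)
    · intro A B
      have h1 := h'.adjacent_iff hn hle
        (a := OrderDual.toDual A.val) (b := OrderDual.toDual B.val) (hn' A.2) (hn' B.2)
      have h2 := hsum A B
      have h3 := A.2
      have h4 := B.2
      have h5 := hrank (A.val ⊓ B.val)
      have h6 : finrank K ↥(A.val ⊓ B.val) = m - 1 ↔
          finrank K (⊤ : Submodule K V) -
            finrank K ↥(A.val ⊓ B.val) = n + 1 := by
        omega
      rw [h6]
      refine h1.trans ?_
      refine and_congr (by simp [Subtype.ext_iff]) ⟨?_, ?_⟩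
      · rintro ⟨c, hc, hca, hcb, hx⟩
        exact ⟨⟨OrderDual.ofDual c, hm' hc⟩, fun he => hca (congrArg Subtype.val he),
          fun he => hcb (congrArg Subtype.val he), fun X => hx _ (hn' X.2)⟩
      · rintro ⟨C, hCA, hCB, hX⟩
        exact ⟨OrderDual.toDual C.val, hn' C.2, fun he => hCA (Subtype.ext he),
          fun he => hCB (Subtype.ext he), fun x hx => hX ⟨OrderDual.ofDual x, hm' hx⟩⟩

/-- A map that preserves adjacency does not increase the distance of Grassmann spaces. -/
theorem GrassmannPoint.le_finrank_inf_add_of_adjacent {K' V' : Type*} [DivisionRing K']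
    [AddCommGroup V'] [Module K' V'] [FiniteDimensional K' V'] {m p : ℕ} (hm : 1 ≤ m)
    (f : GrassmannPoint K V m → GrassmannPoint K' V' p)
    (hf : ∀ A B : GrassmannPoint K V m, finrank K ↥(A.val ⊓ B.val) = m - 1 →
      finrank K' ↥((f A).val ⊓ (f B).val) = p - 1) (k : ℕ) (A B : GrassmannPoint K V m)
    (hAB : m ≤ finrank K ↥(A.val ⊓ B.val) + k) :
    p ≤ finrank K' ↥((f A).val ⊓ (f B).val) + k := by
  have h := isProjectiveRank_finrank (K := K) (V := V)
  have h' := isProjectiveRank_finrank (K := K') (V := V')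
  have hself : ∀ A : GrassmannPoint K V m, finrank K' ↥((f A).val ⊓ (f A).val) = p :=
    fun A => by rw [inf_idem]; exact (f A).2
  induction k generalizing A with
  | zero =>
    have h1 : A.val ⊓ B.val = A.val := h.eq_of_le inf_le_left (by
      have := A.2
      omega)
    have h2 : A.val = B.val := h.eq_of_le (inf_eq_left.1 h1) (by
      have := A.2
      have := B.2
      omega)
    rw [Subtype.ext h2, hself]
    omega
  | succ k ih =>
    by_cases hne : A = B
    · rw [hne, hself]
      omega
    · obtain ⟨c, hc, hac, hcb⟩ := h.exists_closer (a := A.val) (b := B.val)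
        (A.2.trans B.2.symm) fun he => hne (Subtype.ext he)
      have hA := A.2
      let C : GrassmannPoint K V m := ⟨c, hc.trans hA⟩
      have h1 := ih C (by
        change m ≤ finrank K ↥(c ⊓ B.val) + k
        omega)
      have h2 := hf A C (by
        change finrank K ↥(A.val ⊓ c) = m - 1
        omega)
      have h3 := h'.sup_add_inf ((f A).val ⊓ (f C).val) ((f C).val ⊓ (f B).val)
      have h4 := h'.strictMono.monotone
        (sup_le inf_le_right inf_le_left :
          ((f A).val ⊓ (f C).val) ⊔ ((f C).val ⊓ (f B).val) ≤ (f C).val)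
      have h5 := h'.strictMono.monotone
        (le_inf (inf_le_left.trans inf_le_left) (inf_le_right.trans inf_le_right) :
          ((f A).val ⊓ (f C).val) ⊓ ((f C).val ⊓ (f B).val) ≤ (f A).val ⊓ (f B).val)
      have h6 := (f C).2
      omega

end Grassmann


/-- Theorem 3.11 of the paper. Points of the Grassmann space
`G(m, m+n; D)` are the `m`-dimensional subspaces of the `(m+n)`-dimensional left
vector space over `D`; two points `A, B` are adjacent iff `dim (A ⊓ B) = m - 1`,
the graph distance is `d(A,B) = m - dim (A ⊓ B)` and the diameter is `min{m,n}`.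
A surjection `φ : G(m, m+n; D) → G(p, p+q; D')` preserving pairs at maximal
distance in both directions (equivalently, `dim (A ⊓ B) = m - min{m,n}` iff
`dim (A^φ ⊓ B^φ) = p - min{p,q}`) is bijective, preserves adjacency in both
directions, and `min{m,n} = min{p,q}`. -/
theorem stmt_13 {D D' : Type*} [DivisionRing D] [DivisionRing D']
    {m n p q : ℕ} (hm : 2 ≤ m) (hn : 2 ≤ n) (hp : 2 ≤ p) (hq : 2 ≤ q)
    (φ : {W : Submodule D (Fin (m + n) → D) // Module.finrank D W = m} →
         {W : Submodule D' (Fin (p + q) → D') // Module.finrank D' W = p})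
    (hsurj : Function.Surjective φ)
    (hdiam : ∀ A B : {W : Submodule D (Fin (m + n) → D) // Module.finrank D W = m},
      Module.finrank D ↥(A.val ⊓ B.val) = m - min m n ↔
      Module.finrank D' ↥((φ A).val ⊓ (φ B).val) = p - min p q) :
    Function.Bijective φ ∧
    (∀ A B : {W : Submodule D (Fin (m + n) → D) // Module.finrank D W = m},
      Module.finrank D ↥(A.val ⊓ B.val) = m - 1 ↔
      Module.finrank D' ↥((φ A).val ⊓ (φ B).val) = p - 1) ∧
    min m n = min p q := by
  have hD : Module.finrank D (Fin (m + n) → D) = m + n := by simp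
  have hD' : Module.finrank D' (Fin (p + q) → D') = p + q := by simp
  obtain ⟨⟨A₀, B₀, h₀⟩, hsep, hadj⟩ := grassmann_opposite hm hn hD
  obtain ⟨⟨A₁, B₁, h₁⟩, -, hadj'⟩ := grassmann_opposite hp hq hD'
  have hinj : Function.Injective φ := by
    intro A B hAB
    refine hsep A B fun X => ?_
    rw [hdiam, hdiam, hAB]
  have hφ : ∀ A B : {W : Submodule D (Fin (m + n) → D) // Module.finrank D W = m},
      Module.finrank D ↥(A.val ⊓ B.val) = m - 1 ↔
      Module.finrank D' ↥((φ A).val ⊓ (φ B).val) = p - 1 := by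
    intro A B
    rw [hadj, hadj']
    simp only [hsurj.exists, hsurj.forall, ne_eq, hinj.eq_iff, hdiam]
  refine ⟨⟨hinj, hsurj⟩, hφ, ?_⟩
  let e := Equiv.ofBijective φ ⟨hinj, hsurj⟩
  have he : ∀ Y, φ (e.symm Y) = Y := e.apply_symm_apply
  have hle := GrassmannPoint.le_finrank_inf_add_of_adjacent (by omega) φ
    (fun A B => (hφ A B).1) (min m n) A₀ B₀ (by omega)
  have hle' := GrassmannPoint.le_finrank_inf_add_of_adjacent (by omega) e.symm
    (fun A B hAB => (hφ _ _).2 (by rwa [he, he])) (min p q) A₁ B₁ (by omega)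
  rw [(hdiam A₀ B₀).1 h₀] at hle
  rw [(hdiam _ _).2 (by rwa [he, he])] at hle'
  omega
end

section
/- Let F₃ be the field with three elements and consider the symmetric 2×2 matrices over F₃. Let X = [[1,0],[0,2]], Y = [[2,2],[2,1]] and Z = 0 (so that rank(X − Z) = rank(Y − Z) = 2). Then there is no symmetric 2×2 matrix W over F₃ with rank(Z − W) = 1, rank(X − W) = 1, and rank(Y − W) = 2; that is, the graph on S₂(F₃) does not satisfy condition (A4). -/
/-- A square matrix over a field has full row rank iff its determinant is nonzero. -/
theorem rowRank_eq_iff_det_ne_zero {F : Type*} [Field F] {n : ℕ}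
    (A : Matrix (Fin n) (Fin n) F) : rowRank A = n ↔ A.det ≠ 0 := by
  rw [← isUnit_iff_ne_zero, ← Matrix.isUnit_iff_isUnit_det,
    ← Matrix.linearIndependent_rows_iff_isUnit, linearIndependent_iff_card_eq_finrank_span,
    Fintype.card_fin, eq_comm]
  rfl

/-- Example 3.8 of the paper. In the space `S₂(F₃)` of symmetric
`2 × 2` matrices over the field with three elements (a graph of diameter `2` with
distance `d(A,B) = rank (A - B)`), the matrices `X = [[1,0],[0,2]]`,
`Y = [[2,2],[2,1]]` and `Z = 0` satisfy `rank (X - Z) = rank (Y - Z) = 2`, yet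
there is no symmetric `W` with `rank (Z - W) = 1`, `rank (X - W) = 1` and
`rank (Y - W) = 2`; hence condition (A4) fails. -/
theorem stmt_15 :
    rowRank ((!![1, 0; 0, 2] : Matrix (Fin 2) (Fin 2) (ZMod 3)) - 0) = 2 ∧
    rowRank ((!![2, 2; 2, 1] : Matrix (Fin 2) (Fin 2) (ZMod 3)) - 0) = 2 ∧
    ¬ ∃ W : Matrix (Fin 2) (Fin 2) (ZMod 3), W.IsSymm ∧
        rowRank ((0 : Matrix (Fin 2) (Fin 2) (ZMod 3)) - W) = 1 ∧
        rowRank (!![1, 0; 0, 2] - W) = 1 ∧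
        rowRank (!![2, 2; 2, 1] - W) = 2 := by
  simp only [rowRank_eq_iff_det_ne_zero]
  refine ⟨by decide, by decide, ?_⟩
  rintro ⟨W, hW, hZ, hX, hY⟩
  have det_eq_zero {A : Matrix (Fin 2) (Fin 2) (ZMod 3)} (hA : rowRank A = 1) : A.det = 0 := by
    by_contra h
    have := (rowRank_eq_iff_det_ne_zero A).2 h
    omega
  have key : ∀ a b c : ZMod 3, (0 - a) * (0 - c) - (0 - b) * (0 - b) = 0 →
      (1 - a) * (2 - c) - (0 - b) * (0 - b) = 0 →
      (2 - a) * (1 - c) - (2 - b) * (2 - b) = 0 := by decide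
  have hs : W 1 0 = W 0 1 := hW.apply 0 1
  have hZ' := det_eq_zero hZ
  have hX' := det_eq_zero hX
  rw [Matrix.det_fin_two, Matrix.sub_apply, Matrix.sub_apply, Matrix.sub_apply,
    Matrix.sub_apply, hs] at hZ' hX' hY
  exact hY (key _ _ _ hZ' hX')
end

section
/- Let F₃ be the field with three elements and consider the symmetric 2×2 matrices over F₃. Let X = [[1,0],[0,2]], Y = [[2,2],[2,1]] and Z = 0. Then for every symmetric 2×2 matrix M over F₃ with rank(M − Y) = 2 one has rank(M − X) = 2 or rank(M − Z) = 2, and yet rank(X − Z) = 2, so X and Z are not adjacent. (Hence the adjacency criterion of Lemma 2.1 fails without condition (A4).) -/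
/-- A square matrix over a field has full row rank exactly when its determinant is nonzero. -/
theorem rowRank_eq_card_iff_det_ne_zero {K : Type*} [Field K] {n : ℕ}
    (A : Matrix (Fin n) (Fin n) K) : rowRank A = n ↔ A.det ≠ 0 := by
  rw [← isUnit_iff_ne_zero, ← Matrix.isUnit_iff_isUnit_det,
    ← Matrix.linearIndependent_rows_iff_isUnit, linearIndependent_iff_card_eq_finrank_span,
    Fintype.card_fin, eq_comm]
  rfl

/-- Example 3.8 of the paper, continued. In the space `S₂(F₃)` of
symmetric `2 × 2` matrices over the field with three elements (a graph of
diameter `2` with distance `d(A,B) = rank (A - B)`), with `X = [[1,0],[0,2]]`,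
`Y = [[2,2],[2,1]]` and `Z = 0`: every symmetric `M` with `rank (M - Y) = 2`
satisfies `rank (M - X) = 2` or `rank (M - Z) = 2`, and yet `rank (X - Z) = 2`,
so `X` and `Z` are not adjacent. -/
theorem stmt_16 :
    (∀ M : Matrix (Fin 2) (Fin 2) (ZMod 3), M.IsSymm →
      rowRank (M - !![2, 2; 2, 1]) = 2 →
      rowRank (M - !![1, 0; 0, 2]) = 2 ∨ rowRank (M - 0) = 2) ∧
    rowRank ((!![1, 0; 0, 2] : Matrix (Fin 2) (Fin 2) (ZMod 3)) - 0) = 2 ∧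
    rowRank ((!![1, 0; 0, 2] : Matrix (Fin 2) (Fin 2) (ZMod 3)) - 0) ≠ 1 := by
  have hX : rowRank ((!![1, 0; 0, 2] : Matrix (Fin 2) (Fin 2) (ZMod 3)) - 0) = 2 := by
    rw [rowRank_eq_card_iff_det_ne_zero, sub_zero, Matrix.det_fin_two_of]
    decide
  refine ⟨fun M hM => ?_, hX, by omega⟩
  have h := hM.apply 0 1
  simp only [rowRank_eq_card_iff_det_ne_zero, Matrix.det_fin_two, Matrix.sub_apply,
    Matrix.zero_apply, Matrix.of_apply, Matrix.cons_val', Matrix.cons_val_zero,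
    Matrix.cons_val_one, Matrix.cons_val_fin_one, h]
  generalize M 0 0 = a, M 0 1 = b, M 1 1 = d
  revert a b d
  decide
end

section
/- Let Γ be a connected graph with vertex set P and finite diameter diam Γ ≥ 3, and suppose there exist points a, a* ∈ P with a ≠ a*, d(a, a*) = diam Γ, and d(a, x) ≠ diam Γ ≠ d(a*, x) for all x ∈ P \ {a, a*}. Let φ : P → P be the bijection which interchanges a with a* and fixes all other points. Then for all x, y ∈ P one has d(x,y) = diam Γ if and only if d(φ(x), φ(y)) = diam Γ, but φ is not an automorphism of Γ. -/
/-- Example 3.9 of the paper, general observation. If a connected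
graph `G` of finite diameter `≥ 3` has two points `a ≠ a*` at distance `diam G`
such that no other point is at distance `diam G` from `a` or from `a*`, then the
transposition `φ` interchanging `a` and `a*` preserves pairs at distance
`diam G` in both directions, but is not an automorphism of `G`. -/
theorem stmt_18 {V : Type*} [DecidableEq V] (G : SimpleGraph V)
    (hconn : G.Connected) (hfin : G.ediam ≠ ⊤) (h3 : 3 ≤ G.diam)
    (a astar : V) (hne : a ≠ astar) (hd : G.dist a astar = G.diam)
    (hmax : ∀ x : V, x ≠ a → x ≠ astar →
      G.dist a x ≠ G.diam ∧ G.dist astar x ≠ G.diam) :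
    (∀ x y : V, G.dist x y = G.diam ↔
      G.dist (Equiv.swap a astar x) (Equiv.swap a astar y) = G.diam) ∧
    ¬ (∀ x y : V, G.Adj x y ↔
      G.Adj (Equiv.swap a astar x) (Equiv.swap a astar y)) := by
  have hd' : G.dist astar a = G.diam := by rw [SimpleGraph.dist_comm, hd]
  refine ⟨fun x y => ?_, fun h => ?_⟩
  · have hself : ∀ v : V, G.dist v v ≠ G.diam := fun v => by
      rw [SimpleGraph.dist_self]; omega
    have hmax' : ∀ x : V, x ≠ a → x ≠ astar →
        G.dist x a ≠ G.diam ∧ G.dist x astar ≠ G.diam := fun x hxa hxs => by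
      simpa only [SimpleGraph.dist_comm] using hmax x hxa hxs
    simp only [Equiv.swap_apply_def]
    split_ifs <;> subst_vars <;> grind
  · have : Nontrivial V := ⟨a, astar, hne⟩
    obtain ⟨b, hab⟩ := hconn.preconnected.exists_adj_of_nontrivial a
    have hbs : b ≠ astar := by
      rintro rfl
      rw [SimpleGraph.dist_eq_one_iff_adj.mpr hab] at hd
      omega
    have hsb : G.Adj astar b := by
      simpa [Equiv.swap_apply_of_ne_of_ne hab.ne' hbs] using (h a b).mp hab
    have htri := hconn.dist_triangle (u := a) (v := b) (w := astar)
    rw [SimpleGraph.dist_eq_one_iff_adj.mpr hab,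
      SimpleGraph.dist_eq_one_iff_adj.mpr hsb.symm] at htri
    omega
end
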